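/- arXiv:math/0403374 — 7 statements merged into one kernel-verified Lean document; each statement's English description precedes it below -/
import Mathlib

section
/- Let b2, b4, r, s, t, u, z be integers such that r*s ≡ t*u (mod 2), z ≡ r*t (mod 2), and s*u = 2*b4 + b2*z + 3*z^2 + (r*t)^2. Define the integers x1 = (z - r*t)/2, x2 = (z + r*t)/2, y1 = (t*u - r*s)/2, y2 = (r*s + t*u)/2, and b6 = y2^2 - 4*x2^3 - b2*x2^2 - 2*b4*x2. Then (x1, y1) also satisfies the equation, i.e., y1^2 = 4*x1^3 + b2*x1^2 + 2*b4*x1 + b6. -/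
/-- Reconstruction step of the pair-finding algorithm: given integers `b₂, b₄, r, s, t, u, z`
with `rs ≡ tu (mod 2)`, `z ≡ rt (mod 2)`, and `su = 2b₄ + b₂z + 3z² + (rt)²`, setting
`x₁ = (z - rt)/2`, `x₂ = (z + rt)/2`, `y₁ = (tu - rs)/2`, `y₂ = (rs + tu)/2` and
`b₆ = y₂² - 4x₂³ - b₂x₂² - 2b₄x₂`, the point `(x₁, y₁)` also satisfies
`y₁² = 4x₁³ + b₂x₁² + 2b₄x₁ + b₆`. -/
theorem pair_reconstruction (b2 b4 r s t u z x1 x2 y1 y2 b6 : ℤ)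
    (hpar : r * s ≡ t * u [ZMOD 2]) (hz : z ≡ r * t [ZMOD 2])
    (hsu : s * u = 2 * b4 + b2 * z + 3 * z ^ 2 + (r * t) ^ 2)
    (hx1 : x1 = (z - r * t) / 2) (hx2 : x2 = (z + r * t) / 2)
    (hy1 : y1 = (t * u - r * s) / 2) (hy2 : y2 = (r * s + t * u) / 2)
    (hb6 : b6 = y2 ^ 2 - 4 * x2 ^ 3 - b2 * x2 ^ 2 - 2 * b4 * x2) :
    y1 ^ 2 = 4 * x1 ^ 3 + b2 * x1 ^ 2 + 2 * b4 * x1 + b6 := by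
  have hrs : r * s = y2 - y1 := by
    unfold Int.ModEq at hpar
    omega
  have htu : t * u = y2 + y1 := by
    unfold Int.ModEq at hpar
    omega
  have hrt : r * t = x2 - x1 := by
    unfold Int.ModEq at hz
    omega
  have hzx : z = x1 + x2 := by
    unfold Int.ModEq at hz
    omega
  have hy : (r * s) * (t * u) = (y2 - y1) * (y2 + y1) := by rw [hrs, htu]
  have hx : (r * t) * (s * u) = (x2 - x1) *
      (2 * b4 + b2 * (x1 + x2) + 3 * (x1 + x2) ^ 2 + (x2 - x1) ^ 2) := by
    rw [hsu, hrt, hzx]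
  rw [hb6]
  linear_combination hy - hx
end

section
/- The elliptic curve over Q given by the Weierstrass equation y^2 + y = x^3 - 79x + 342 (coefficients [a1,a2,a3,a4,a6] = [0,0,1,-79,342]) has discriminant of absolute value 19047851, and its group of rational points contains 5 points that are linearly independent over Z (so the curve has Mordell–Weil rank at least 5). -/
/-- In an abelian group without `2`-torsion, a finite family none of whose nonempty subsums is
divisible by `2` is linearly independent over `ℤ`. -/
theorem linearIndependent_int_of_subsum_ne_two_nsmul {G ι : Type*} [AddCommGroup G] [Fintype ι]
    {P : ι → G} (htors : ∀ R : G, 2 • R = 0 → R = 0)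
    (hP : ∀ S : Finset ι, S.Nonempty → ∀ R : G, ∑ i ∈ S, P i ≠ 2 • R) :
    LinearIndependent ℤ P := by
  have even_coeff (g : ι → ℤ) (hg : ∑ i, g i • P i = 0) (i : ι) : 2 ∣ g i := by
    by_contra hi
    refine hP {j | ¬ 2 ∣ g j} ⟨i, by simpa using hi⟩ (-∑ j, (g j / 2) • P j) ?_
    have hsum : ∑ j, g j • P j =
        2 • ∑ j, (g j / 2) • P j + ∑ j with ¬ 2 ∣ g j, P j := by
      rw [Finset.sum_filter, Finset.smul_sum, ← Finset.sum_add_distrib]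
      refine Finset.sum_congr rfl fun j _ ↦ ?_
      rw [← natCast_zsmul, smul_smul]
      by_cases h : 2 ∣ g j
      · rw [if_neg (not_not.mpr h), add_zero]
        nth_rw 1 [show g j = ((2 : ℕ) : ℤ) * (g j / 2) by omega]
      · rw [if_pos h]
        nth_rw 1 [show g j = ((2 : ℕ) : ℤ) * (g j / 2) + 1 by omega]
        rw [add_smul, one_smul]
    rw [smul_neg, eq_neg_iff_add_eq_zero, add_comm, ← hsum, hg]
  have pow_dvd_coeff (n : ℕ) : ∀ g : ι → ℤ, ∑ i, g i • P i = 0 → ∀ i, 2 ^ n ∣ g i := by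
    induction n with
    | zero => simp
    | succ n ih =>
      intro g hg i
      choose h hh using even_coeff g hg
      have hsum : ∑ j, h j • P j = 0 := by
        refine htors _ ?_
        rw [← hg, Finset.smul_sum]
        refine Finset.sum_congr rfl fun j _ ↦ ?_
        rw [hh j, ← natCast_zsmul, smul_smul, Nat.cast_ofNat]
      rw [hh i, pow_succ']
      exact mul_dvd_mul_left 2 (ih h hsum i)
  rw [Fintype.linearIndependent_iff]
  intro g hg i
  refine Int.eq_zero_of_abs_lt_dvd (pow_dvd_coeff (g i).natAbs g hg i) ?_
  rw [Int.abs_eq_natAbs]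
  exact_mod_cast Nat.lt_two_pow_self

namespace LowConductorCurve

open WeierstrassCurve.Affine

/-- The Weierstrass curve `y² + y = x³ - 79x + 342`. -/
abbrev curve : WeierstrassCurve ℚ := ⟨0, 0, 1, -79, 342⟩

/-- The integral binary quartic form whose vanishing at `(a, b)` says that doubling a point with
`x`-coordinate `a / b` gives a point with `x`-coordinate `x`. -/
def halvingForm (x : ℚ) (a b : ℤ) : ℤ :=
  x.den * (a ^ 4 + 158 * a ^ 2 * b ^ 2 - 2738 * a * b ^ 3 + 6241 * b ^ 4) -
    x.num * b * (4 * a ^ 3 - 316 * a * b ^ 2 + 1369 * b ^ 3)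

/-- The halving form of `x` has no nontrivial zero modulo `q`. -/
def HasObstruction (x : ℚ) (q : ℕ) : Prop :=
  ∀ a < q, ∀ b < q, (q : ℤ) ∣ halvingForm x a b → a = 0 ∧ b = 0

instance (x : ℚ) : DecidablePred (HasObstruction x) := fun q ↦
  inferInstanceAs (Decidable (∀ a < q, ∀ b < q, (q : ℤ) ∣ halvingForm x a b → a = 0 ∧ b = 0))

/-- An affine point whose halving form has no nontrivial zero modulo one of a few small primes. -/
def LocallyNotDouble : curve.toAffine.Point → Prop
  | .zero => False
  | .some x _ _ => ∃ q ∈ [7, 11, 17, 19, 23], HasObstruction x q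

instance : DecidablePred LocallyNotDouble
  | .zero => inferInstanceAs (Decidable False)
  | .some x _ _ => inferInstanceAs (Decidable (∃ q ∈ [7, 11, 17, 19, 23], HasObstruction x q))

theorem halvingForm_ne_zero {x : ℚ} {q : ℕ} (hq : 1 < q) (h : HasObstruction x q) {a b : ℤ}
    (hab : IsCoprime a b) : halvingForm x a b ≠ 0 := by
  intro h0
  have hq0 : (q : ℤ) ≠ 0 := by omega
  have residue (c : ℤ) : ∃ r < q, (r : ℤ) ≡ c [ZMOD q] := by
    refine ⟨(c % q).toNat, ?_, ?_⟩
    · have := Int.emod_lt_of_pos c (by omega : (0 : ℤ) < q)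
      omega
    · rw [Int.toNat_of_nonneg (Int.emod_nonneg c hq0)]
      exact Int.mod_modEq c q
  obtain ⟨r, hr, hra⟩ := residue a
  obtain ⟨s, hs, hsb⟩ := residue b
  have hform : halvingForm x r s ≡ halvingForm x a b [ZMOD q] := by
    unfold halvingForm
    gcongr
  rw [h0] at hform
  obtain ⟨rfl, rfl⟩ := h r hr s hs (Int.modEq_zero_iff_dvd.mp hform)
  have hunit := hab.isUnit_of_dvd' (Int.modEq_zero_iff_dvd.mp hra.symm)
    (Int.modEq_zero_iff_dvd.mp hsb.symm)
  rw [Int.isUnit_iff] at hunit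
  omega

theorem two_nsmul_some {x y : ℚ} (h : curve.toAffine.Nonsingular x y) (hy : 2 * y + 1 ≠ 0) :
    ∃ x' y' h', 2 • Point.some x y h = Point.some x' y' h' ∧
      x' * (2 * y + 1) ^ 2 = (3 * x ^ 2 - 79) ^ 2 - 2 * x * (2 * y + 1) ^ 2 := by
  have hne : y ≠ curve.toAffine.negY x y := by
    intro hy'
    simp only [negY] at hy'
    exact hy (by linear_combination hy')
  have hx : curve.toAffine.addX x x (curve.toAffine.slope x x y y) =
      ((3 * x ^ 2 - 79) / (2 * y + 1)) ^ 2 - 2 * x := by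
    rw [slope_of_Y_ne rfl hne]
    simp only [addX, negY]
    ring_nf
  refine ⟨_, _, _, (two_nsmul _).trans (Point.add_self_of_Y_ne hne), ?_⟩
  rw [hx]
  field_simp

theorem eq_zero_of_two_nsmul_eq_zero (R : curve.toAffine.Point) (hR : 2 • R = 0) : R = 0 := by
  rcases R with _ | ⟨x, y, h⟩
  · rfl
  by_cases hy : 2 * y + 1 = 0
  · have heq := (equation_iff _ _).mp h.left
    have hb : (x.den : ℚ) ≠ 0 := by exact_mod_cast x.den_ne_zero
    have hint : 4 * x.num ^ 3 - 316 * x.num * x.den ^ 2 + 1369 * (x.den : ℤ) ^ 3 = 0 := by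
      have hcubic : 4 * x ^ 3 - 316 * x + 1369 = 0 := by
        linear_combination -4 * heq + (2 * y + 1) * hy
      rw [← x.num_div_den] at hcubic
      field_simp at hcubic
      exact_mod_cast (by linear_combination hcubic :
        (4 * x.num ^ 3 - 316 * x.num * x.den ^ 2 + 1369 * x.den ^ 3 : ℚ) = 0)
    have hmod : ∀ a b : ZMod 3, 4 * a ^ 3 - 316 * a * b ^ 2 + 1369 * b ^ 3 = 0 →
        a = 0 ∧ b = 0 := by decide
    obtain ⟨ha, hb'⟩ := hmod x.num x.den (by exact_mod_cast congrArg (Int.cast : ℤ → ZMod 3) hint)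
    have hdvd : 3 ∣ x.num.natAbs.gcd x.den :=
      Nat.dvd_gcd (Int.natCast_dvd.mp ((ZMod.intCast_zmod_eq_zero_iff_dvd _ 3).mp ha))
        ((ZMod.natCast_eq_zero_iff _ 3).mp hb')
    rw [x.reduced] at hdvd
    omega
  · obtain ⟨_, _, h', hdouble, -⟩ := two_nsmul_some h hy
    exact absurd (hdouble.symm.trans hR) (Point.some_ne_zero h')

theorem LocallyNotDouble.ne_two_nsmul {Q : curve.toAffine.Point} (hQ : LocallyNotDouble Q)
    (R : curve.toAffine.Point) : Q ≠ 2 • R := by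
  rintro rfl
  rcases R with _ | ⟨x, y, h⟩
  · exact hQ
  by_cases hy : 2 * y + 1 = 0
  · have hzero : 2 • Point.some x y h = 0 := by
      rw [two_nsmul]
      refine Point.add_self_of_Y_eq ?_
      simp only [negY]
      linear_combination hy
    rw [hzero] at hQ
    exact hQ
  · obtain ⟨X, _, _, hdouble, hmul⟩ := two_nsmul_some h hy
    rw [hdouble] at hQ
    obtain ⟨q, hq, hobs⟩ := hQ
    have hq1 : 1 < q := by
      fin_cases hq <;> norm_num
    refine halvingForm_ne_zero hq1 hobs (Rat.isCoprime_num_den x) ?_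
    have heq := (equation_iff _ _).mp h.left
    have hXd : (X.den : ℚ) ≠ 0 := by exact_mod_cast X.den_ne_zero
    have hxd : (x.den : ℚ) ≠ 0 := by exact_mod_cast x.den_ne_zero
    have hquartic : x ^ 4 + 158 * x ^ 2 - 2738 * x + 6241 = X * (4 * x ^ 3 - 316 * x + 1369) := by
      have hsq : 4 * x ^ 3 - 316 * x + 1369 = (2 * y + 1) ^ 2 := by
        linear_combination -4 * heq
      rw [hsq, hmul, ← hsq]
      ring
    rw [← X.num_div_den, ← x.num_div_den] at hquartic
    field_simp at hquartic
    unfold halvingForm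
    rw [← Int.cast_inj (α := ℚ)]
    push_cast
    linear_combination hquartic

theorem nonsingular_of_equation {x y : ℚ} (h : y ^ 2 + y = x ^ 3 - 79 * x + 342) :
    curve.toAffine.Nonsingular x y := by
  refine (equation_iff_nonsingular_of_Δ_ne_zero ?_).mp ((equation_iff _ _).mpr ?_)
  · norm_num [WeierstrassCurve.Δ, WeierstrassCurve.b₂, WeierstrassCurve.b₄, WeierstrassCurve.b₆,
      WeierstrassCurve.b₈]
  · linear_combination h

/-- Five independent integral points. -/
def generators : Fin 5 → curve.toAffine.Point :=
  ![.some 0 18 (nonsingular_of_equation (by norm_num)),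
    .some 3 11 (nonsingular_of_equation (by norm_num)),
    .some 4 9 (nonsingular_of_equation (by norm_num)),
    .some 5 8 (nonsingular_of_equation (by norm_num)),
    .some 7 11 (nonsingular_of_equation (by norm_num))]

theorem locallyNotDouble_sum_generators :
    ∀ S : Finset (Fin 5), S.Nonempty → LocallyNotDouble (∑ i ∈ S, generators i) := by
  decide +kernel

end LowConductorCurve


/-- The elliptic curve `y² + y = x³ - 79x + 342` (i.e. `[0,0,1,-79,342]`) has discriminant of
absolute value `19047851`, and its group of rational points contains `5` points that are
linearly independent over `ℤ` (so its Mordell–Weil rank is at least `5`). -/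
theorem rank5_low_conductor_curve (W : WeierstrassCurve ℚ)
    (hW : W = ⟨0, 0, 1, -79, 342⟩) :
    |W.Δ| = 19047851 ∧
      ∃ P : Fin 5 → W.toAffine.Point, LinearIndependent ℤ P := by
  subst hW
  refine ⟨?_, LowConductorCurve.generators, ?_⟩
  · norm_num [WeierstrassCurve.Δ, WeierstrassCurve.b₂, WeierstrassCurve.b₄, WeierstrassCurve.b₆,
      WeierstrassCurve.b₈]
  · exact linearIndependent_int_of_subsum_ne_two_nsmul
      LowConductorCurve.eq_zero_of_two_nsmul_eq_zero
      fun S hS ↦ (LowConductorCurve.locallyNotDouble_sum_generators S hS).ne_two_nsmul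
end

section
/- The elliptic curve over Q given by the Weierstrass equation y^2 + xy = x^3 + x^2 - 2582x + 48720 (coefficients [a1,a2,a3,a4,a6] = [1,1,0,-2582,48720]) has discriminant of absolute value 6 * 5187563742, and its group of rational points contains 6 points that are linearly independent over Z (so the curve has Mordell–Weil rank at least 6). -/
open WeierstrassCurve

/-- In an additive commutative group without `2`-torsion, a finite family no nonempty subsum of which
is divisible by `2` is linearly independent over `ℤ`. -/
theorem linearIndependent_int_of_sum_ne_two_nsmul {ι G : Type*} [Fintype ι] [AddCommGroup G]
    (P : ι → G) (htors : ∀ g : G, 2 • g = 0 → g = 0)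
    (hP : ∀ s : Finset ι, s.Nonempty → ∀ Q : G, ∑ i ∈ s, P i ≠ 2 • Q) :
    LinearIndependent ℤ P := by
  classical
  have halve (c : ι → ℤ) (hc : ∑ i, c i • P i = 0) :
      (∀ i, c i % 2 = 0) ∧ ∑ i, (c i / 2) • P i = 0 := by
    have hsplit : ∑ i, c i • P i = 2 • ∑ i, (c i / 2) • P i + ∑ i with c i % 2 ≠ 0, P i := by
      rw [Finset.sum_filter, Finset.smul_sum, ← Finset.sum_add_distrib]
      refine Finset.sum_congr rfl fun i _ ↦ ?_
      have hdiv := Int.mul_ediv_add_emod (c i) 2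
      rcases Int.emod_two_eq_zero_or_one (c i) with h | h <;> rw [h] at hdiv <;>
        conv_lhs => rw [← hdiv]
      · simp [h, mul_smul, two_smul]
      · simp [h, mul_smul, add_smul, two_smul]
    have heven : ∀ i, c i % 2 = 0 := by
      by_contra! hodd
      obtain ⟨i, hi⟩ := hodd
      refine hP {i | c i % 2 ≠ 0} ⟨i, by simpa using hi⟩ (-∑ i, (c i / 2) • P i) ?_
      rw [smul_neg, eq_neg_iff_add_eq_zero, add_comm, ← hsplit, hc]
    refine ⟨heven, htors _ ?_⟩
    simpa [hc, heven] using hsplit.symm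
  have hpow (k : ℕ) : ∀ c : ι → ℤ, ∑ i, c i • P i = 0 → ∀ i, (2 : ℤ) ^ k ∣ c i := by
    induction k with
    | zero => simp
    | succ k ih =>
      intro c hc i
      obtain ⟨heven, hhalf⟩ := halve c hc
      rw [← Int.mul_ediv_cancel' (Int.dvd_of_emod_eq_zero (heven i)), pow_succ']
      exact mul_dvd_mul_left 2 (ih _ hhalf i)
  refine Fintype.linearIndependent_iff.mpr fun c hc i ↦ ?_
  refine Int.eq_zero_of_abs_lt_dvd (hpow (c i).natAbs c hc i) ?_
  rw [Int.abs_eq_natAbs]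
  exact_mod_cast Nat.lt_two_pow_self

theorem sum_mul_div_pow_mul_pow {K : Type*} [Field K] {n : ℕ} (c : Fin (n + 1) → K) (u : K) {v : K}
    (hv : v ≠ 0) :
    (∑ i, c i * (u / v) ^ (i : ℕ)) * v ^ n = ∑ i, c i * (u ^ (i : ℕ) * v ^ (n - (i : ℕ))) := by
  rw [Finset.sum_mul]
  refine Finset.sum_congr rfl fun i _ ↦ ?_
  have hpow : v ^ n = v ^ (i : ℕ) * v ^ (n - (i : ℕ)) := by
    rw [← pow_add, Nat.add_sub_of_le (Nat.lt_succ_iff.mp i.isLt)]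
  rw [hpow, div_pow]
  field_simp

/-- The polynomial `∑ cᵢ Xⁱ` has no zero on the projective line over `ℤ/p`. -/
abbrev NoRootMod (p : ℕ) {n : ℕ} (c : Fin (n + 1) → ℤ) [NeZero p] : Prop :=
  (c (Fin.last n) : ZMod p) ≠ 0 ∧ ∀ t : ZMod p, ∑ i, (c i : ZMod p) * t ^ (i : ℕ) ≠ 0

theorem NoRootMod.sum_ne_zero {p : ℕ} [Fact p.Prime] {n : ℕ} {c : Fin (n + 1) → ℤ}
    (h : NoRootMod p c) (x : ℚ) : ∑ i, (c i : ℚ) * x ^ (i : ℕ) ≠ 0 := by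
  intro hx
  have hhom : ∑ i, c i * (x.num ^ (i : ℕ) * (x.den : ℤ) ^ (n - (i : ℕ))) = 0 := by
    have hsum := sum_mul_div_pow_mul_pow (fun i ↦ (c i : ℚ)) x.num
      (Nat.cast_ne_zero.mpr x.den_ne_zero)
    rw [x.num_div_den, hx, zero_mul] at hsum
    exact_mod_cast hsum.symm
  replace hhom := congrArg (Int.cast : ℤ → ZMod p) hhom
  push_cast at hhom
  by_cases hv : (x.den : ZMod p) = 0
  · rw [Fin.sum_univ_castSucc, Finset.sum_eq_zero, zero_add] at hhom
    · have hnum : (x.num : ZMod p) ≠ 0 := by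
        intro hu
        rw [ZMod.intCast_zmod_eq_zero_iff_dvd, Int.natCast_dvd] at hu
        rw [ZMod.natCast_eq_zero_iff] at hv
        exact (Fact.out : p.Prime).not_dvd_one (x.reduced ▸ Nat.dvd_gcd hu hv)
      simp [h.1, hnum] at hhom
    · intro i _
      rw [hv, Fin.val_castSucc, zero_pow (Nat.sub_ne_zero_of_lt i.isLt), mul_zero, mul_zero]
  · rw [← sum_mul_div_pow_mul_pow _ _ hv] at hhom
    exact h.2 _ ((mul_eq_zero_iff_right (pow_ne_zero n hv)).mp hhom)

namespace WeierstrassCurve.Affine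

section Field

variable {F : Type*} [Field F] [DecidableEq F] (W : WeierstrassCurve.Affine F)

/-- Doubling a point of order two gives a root of the `2`-division polynomial. -/
theorem twoTorsion_of_two_nsmul_eq_zero {x y : F} {h : W.Nonsingular x y}
    (h2 : 2 • Point.some x y h = 0) :
    4 * x ^ 3 + W.b₂ * x ^ 2 + 2 * W.b₄ * x + W.b₆ = 0 := by
  have heq := (W.equation_iff' x y).mp h.1
  by_cases hy : y = W.negY x y
  · rw [negY] at hy
    simp only [b₂, b₄, b₆]
    linear_combination -4 * heq + (2 * y + W.a₁ * x + W.a₃) * hy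
  · rw [two_nsmul, Point.add_self_of_Y_ne hy] at h2
    exact absurd h2 (Point.some_ne_zero _)

/-- The duplication formula for the `x`-coordinate. -/
theorem duplication_of_two_nsmul_eq_some {x y x' y' : F} {h : W.Nonsingular x y}
    {h' : W.Nonsingular x' y'} (h2 : 2 • Point.some x y h = Point.some x' y' h') :
    x ^ 4 - W.b₄ * x ^ 2 - 2 * W.b₆ * x - W.b₈ =
      x' * (4 * x ^ 3 + W.b₂ * x ^ 2 + 2 * W.b₄ * x + W.b₆) := by
  have heq := (W.equation_iff' x y).mp h.1
  by_cases hy : y = W.negY x y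
  · rw [two_nsmul, Point.add_self_of_Y_eq hy] at h2
    exact absurd h2.symm (Point.some_ne_zero _)
  · rw [two_nsmul, Point.add_self_of_Y_ne hy, Point.some.injEq] at h2
    have hx := h2.1
    have hd : y - W.negY x y ≠ 0 := sub_ne_zero.mpr hy
    have hl := W.slope_of_Y_ne rfl hy
    rw [eq_div_iff hd] at hl
    rw [addX] at hx
    generalize W.slope x x y y = l at hx hl
    rw [negY] at hl
    simp only [b₂, b₄, b₆, b₈]
    linear_combination (2 * y + W.a₁ * x + W.a₃) ^ 2 * hx -
      ((l + W.a₁) * (2 * y + W.a₁ * x + W.a₃) +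
        (3 * x ^ 2 + 2 * W.a₂ * x + W.a₄ - W.a₁ * y)) * hl +
      (4 * x' + W.a₁ ^ 2 + 4 * W.a₂ + 8 * x) * heq

/-- The addition law on pairs of coordinates, meaningful when the `x`-coordinates differ. -/
def addCoords (p q : F × F) : F × F :=
  (W.addX p.1 q.1 (W.slope p.1 q.1 p.2 q.2), W.addY p.1 q.1 p.2 (W.slope p.1 q.1 p.2 q.2))

/-- The coordinates of all nonempty subsums of a list of points. -/
def subsumCoords : List (F × F) → List (F × F)
  | [] => []
  | p :: l => p :: (subsumCoords l ++ (subsumCoords l).map (W.addCoords p))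

/-- No two points with the same `x`-coordinate are added in the computation of `subsumCoords`. -/
def SubsumsDefined : List (F × F) → Prop
  | [] => True
  | p :: l => SubsumsDefined l ∧ ∀ q ∈ W.subsumCoords l, p.1 ≠ q.1

instance decidableSubsumsDefined : DecidablePred W.SubsumsDefined
  | [] => inferInstanceAs (Decidable True)
  | p :: l =>
    have := decidableSubsumsDefined l
    inferInstanceAs (Decidable (W.SubsumsDefined l ∧ ∀ q ∈ W.subsumCoords l, p.1 ≠ q.1))

/-- The point `P` has the pair `p` as its affine coordinates. -/
def HasCoords (P : W.Point) (p : F × F) : Prop :=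
  ∃ h, P = Point.some p.1 p.2 h

variable {W}

theorem HasCoords.add {P Q : W.Point} {p q : F × F} (hP : W.HasCoords P p)
    (hQ : W.HasCoords Q q) (hpq : p.1 ≠ q.1) : W.HasCoords (P + Q) (W.addCoords p q) := by
  obtain ⟨_, rfl⟩ := hP
  obtain ⟨_, rfl⟩ := hQ
  exact ⟨_, Point.add_of_X_ne hpq⟩

theorem sum_eq_zero_or_hasCoords {n : ℕ} {P : Fin n → W.Point} {p : Fin n → F × F}
    (hP : ∀ i, W.HasCoords (P i) (p i)) (hp : W.SubsumsDefined (List.ofFn p))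
    (s : Finset (Fin n)) :
    s = ∅ ∨ ∃ q ∈ W.subsumCoords (List.ofFn p), W.HasCoords (∑ i ∈ s, P i) q := by
  induction n with
  | zero => exact Or.inl (Subsingleton.elim _ _)
  | succ n ih =>
    rw [List.ofFn_succ] at hp ⊢
    have hsum : ∑ i ∈ s, P i =
        (if 0 ∈ s then P 0 else 0) + ∑ i with Fin.succ i ∈ s, P i.succ := by
      rw [← Fintype.sum_ite_mem, Finset.sum_filter, Fin.sum_univ_succ]
    rcases ih (fun i ↦ hP i.succ) hp.1 {i | Fin.succ i ∈ s} with hs | ⟨q, hq, hQ⟩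
    · by_cases h0 : 0 ∈ s
      · refine Or.inr ⟨p 0, by simp [subsumCoords], ?_⟩
        simpa [hsum, hs, h0] using hP 0
      · refine Or.inl (Finset.eq_empty_of_forall_notMem fun i hi ↦ ?_)
        cases i using Fin.cases with
        | zero => exact h0 hi
        | succ i => exact Finset.notMem_empty i (hs ▸ by simpa using hi)
    · right
      by_cases h0 : 0 ∈ s
      · refine ⟨W.addCoords (p 0) q, ?_, ?_⟩
        · simp only [subsumCoords, List.mem_cons, List.mem_append, List.mem_map]
          exact Or.inr (Or.inr ⟨q, hq, rfl⟩)
        · rw [hsum, if_pos h0]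
          exact (hP 0).add hQ (hp.2 q hq)
      · refine ⟨q, ?_, ?_⟩
        · simp [subsumCoords, hq]
        · rwa [hsum, if_neg h0, zero_add]

end Field

end WeierstrassCurve.Affine

/-- The elliptic curve `y² + xy = x³ + x² - 2582x + 48720`. -/
abbrev rankSixCurve : WeierstrassCurve ℚ := ⟨1, 1, 0, -2582, 48720⟩

/-- Integral points on `rankSixCurve`, independent modulo `2`. -/
def rankSixCoords : Fin 6 → ℚ × ℚ :=
  ![(-59, 35), (-58, 116), (-57, 150), (-40, 320), (-32, 332), (-22, 320)]

/-- The coefficients of the quartic whose roots are the `x`-coordinates of the points `Q` on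
`rankSixCurve` such that `2Q` has `x`-coordinate `x`, cleared of denominators. -/
def halvingCoeffs (x : ℚ) : Fin 5 → ℤ :=
  ![6423124 * x.den - 194880 * x.num, -389760 * x.den + 10328 * x.num,
    5164 * x.den - 5 * x.num, -4 * x.num, x.den]

theorem rankSixCurve_eq_zero_of_two_nsmul (Q : rankSixCurve.toAffine.Point) (hQ : 2 • Q = 0) :
    Q = 0 := by
  rcases Q with _ | ⟨x, y, h⟩
  · rfl
  · have hx := Affine.twoTorsion_of_two_nsmul_eq_zero _ hQ
    have : Fact (Nat.Prime 17) := ⟨by norm_num⟩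
    have hroot : NoRootMod 17 ![194880, -10328, 5, 4] := by decide +kernel
    refine absurd ?_ (hroot.sum_ne_zero x)
    norm_num [b₂, b₄, b₆] at hx
    simp [Fin.sum_univ_four]
    linear_combination hx

theorem rankSixCurve_ne_two_nsmul {P : rankSixCurve.toAffine.Point} {q : ℚ × ℚ}
    (hP : Affine.HasCoords _ P q) {p : ℕ} [Fact p.Prime] (hq : NoRootMod p (halvingCoeffs q.1))
    (Q : rankSixCurve.toAffine.Point) : P ≠ 2 • Q := by
  obtain ⟨h', rfl⟩ := hP
  rcases Q with _ | ⟨x, y, h⟩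
  · intro h2
    exact Affine.Point.some_ne_zero h' (h2.trans (nsmul_zero 2))
  · intro h2
    have hx := Affine.duplication_of_two_nsmul_eq_some _ h2.symm
    refine hq.sum_ne_zero x ?_
    norm_num [b₂, b₄, b₆, b₈] at hx
    simp [Fin.sum_univ_five, halvingCoeffs]
    have hnum : (q.1.num : ℚ) = q.1 * q.1.den := (Rat.mul_den_eq_num q.1).symm
    rw [hnum]
    linear_combination (q.1.den : ℚ) * hx

theorem rankSixCurve_subsumCoords :
    Affine.SubsumsDefined rankSixCurve (List.ofFn rankSixCoords) ∧
      ∀ q ∈ Affine.subsumCoords rankSixCurve (List.ofFn rankSixCoords),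
        NoRootMod 31 (halvingCoeffs q.1) ∨ NoRootMod 41 (halvingCoeffs q.1) ∨
          NoRootMod 103 (halvingCoeffs q.1) := by
  decide +kernel

theorem rankSixCurve_nonsingular (i : Fin 6) :
    rankSixCurve.toAffine.Nonsingular (rankSixCoords i).1 (rankSixCoords i).2 := by
  rw [Affine.nonsingular_iff, Affine.equation_iff]
  fin_cases i <;> norm_num [rankSixCoords]

/-- The elliptic curve `[1, 1, 0, -2582, 48720]` has discriminant of absolute value `6 * 5187563742`,
and its group of rational points contains `6` points that are linearly independent
over `ℤ` (so its Mordell–Weil rank is at least `6`). -/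
theorem rank6_low_conductor_curve (W : WeierstrassCurve ℚ)
    (hW : W = ⟨1, 1, 0, -2582, 48720⟩) :
    |W.Δ| = 6 * 5187563742 ∧
      ∃ P : Fin 6 → W.toAffine.Point, LinearIndependent ℤ P := by
  subst hW
  refine ⟨by norm_num [Δ, b₂, b₄, b₆, b₈],
    fun i ↦ Affine.Point.some _ _ (rankSixCurve_nonsingular i), ?_⟩
  refine linearIndependent_int_of_sum_ne_two_nsmul _ rankSixCurve_eq_zero_of_two_nsmul ?_
  intro s hs
  obtain ⟨hdef, hroot⟩ := rankSixCurve_subsumCoords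
  rcases Affine.sum_eq_zero_or_hasCoords (fun i ↦ ⟨rankSixCurve_nonsingular i, rfl⟩) hdef s with
    rfl | ⟨q, hq, hsum⟩
  · exact absurd hs Finset.not_nonempty_empty
  · have : Fact (Nat.Prime 31) := ⟨by norm_num⟩
    have : Fact (Nat.Prime 41) := ⟨by norm_num⟩
    have : Fact (Nat.Prime 103) := ⟨by norm_num⟩
    rcases hroot q hq with h | h | h <;> exact rankSixCurve_ne_two_nsmul hsum h
end

section
/- The elliptic curve over Q given by the Weierstrass equation y^2 + xy = x^3 - x^2 - 106384x + 13075804 (coefficients [a1,a2,a3,a4,a6] = [1,-1,0,-106384,13075804]) has discriminant of absolute value 14 * 249649566346838, and its group of rational points contains 8 points that are linearly independent over Z (so the curve has Mordell–Weil rank at least 8). -/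
open Polynomial WeierstrassCurve

/-- A family in an abelian group without 2-torsion is independent over `ℤ` as soon as it has a
dual family of `±1`-valued characters. -/
theorem linearIndependent_int_of_dual_signs {A ι : Type*} [AddCommGroup A] [Fintype ι]
    [DecidableEq ι] {P : ι → A} (χ : ι → A →+ Additive ℤˣ)
    (hχ : ∀ i j, (χ i (P j)).toMul = if i = j then -1 else 1)
    (htors : ∀ a : A, 2 • a = 0 → a = 0) : LinearIndependent ℤ P := by
  have even_coeff : ∀ g : ι → ℤ, ∑ j, g j • P j = 0 → ∀ i, Even (g i) := by
    intro g hg i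
    have h := congrArg (fun a => (χ i a).toMul) hg
    simp only [map_sum, map_zsmul, map_zero, toMul_sum, toMul_zsmul, hχ, toMul_zero] at h
    rw [Finset.prod_eq_single i (by intro j _ hj; simp [hj.symm]) (by simp)] at h
    by_contra hodd
    rw [Int.not_even_iff_odd] at hodd
    obtain ⟨k, hk⟩ := hodd
    rw [if_pos rfl, hk, zpow_add, zpow_mul] at h
    norm_num at h
  have pow_dvd : ∀ n : ℕ, ∀ g : ι → ℤ, ∑ j, g j • P j = 0 → ∀ i, (2 : ℤ) ^ n ∣ g i := by
    intro n
    induction n with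
    | zero => simp
    | succ n ih =>
      intro g hg i
      choose k hk using fun j => (even_coeff g hg j).two_dvd
      have hsum : ∑ j, k j • P j = 0 := by
        apply htors
        rw [← hg, Finset.smul_sum]
        refine Finset.sum_congr rfl fun j _ => ?_
        rw [hk j, mul_smul, ← natCast_zsmul]
        rfl
      rw [hk i, pow_succ']
      exact mul_dvd_mul_left 2 (ih k hsum i)
  rw [Fintype.linearIndependent_iff]
  intro g hg i
  refine Int.eq_zero_of_abs_lt_dvd (pow_dvd (g i).natAbs g hg i) ?_
  rw [Int.abs_eq_natAbs]
  exact_mod_cast Nat.lt_two_pow_self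

section Descent

variable {K L : Type*} [Field K] [Field L] [Algebra K L] {W : WeierstrassCurve K} {θ : L}

/-- If three points on a line have abscissae `x₁`, `x₂`, `x₃`, then
`4 (x₁ - θ) (x₂ - θ) (x₃ - θ)` is a square for every root `θ` of the 2-torsion polynomial. -/
theorem exists_sq_eq_mul_sub_root [DecidableEq K]
    (hθ : aeval θ W.twoTorsionPolynomial.toPoly = 0) {x₁ x₂ y₁ y₂ : K}
    (h₁ : W.toAffine.Equation x₁ y₁) (h₂ : W.toAffine.Equation x₂ y₂)
    (hxy : ¬(x₁ = x₂ ∧ y₁ = W.toAffine.negY x₂ y₂)) :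
    ∃ s : L, (algebraMap K L x₁ - θ) * (algebraMap K L x₂ - θ) *
      (algebraMap K L (W.toAffine.addX x₁ x₂ (W.toAffine.slope x₁ x₂ y₁ y₂)) - θ) * 2 ^ 2 =
        s ^ 2 := by
  have h := congrArg (aeval θ) (Affine.addPolynomial_slope h₁ h₂ hxy)
  generalize W.toAffine.slope x₁ x₂ y₁ y₂ = ℓ at *
  generalize W.toAffine.addX x₁ x₂ ℓ = x₃ at *
  rw [Affine.addPolynomial_eq] at h
  simp only [twoTorsionPolynomial, Cubic.toPoly, b₂, b₄, b₆, map_add, map_mul, map_sub, map_neg,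
    map_pow, aeval_C, aeval_X, map_ofNat, map_one] at h hθ
  refine ⟨2 * (algebraMap K L ℓ * (θ - algebraMap K L x₁) + algebraMap K L y₁) +
    algebraMap K L W.a₁ * θ + algebraMap K L W.a₃, ?_⟩
  linear_combination -4 * h - hθ

/-- The 2-descent map attached to a root `θ` of the 2-torsion polynomial that is not `K`-rational,
followed by a `±1`-valued character of `Lˣ`. -/
theorem exists_descent_character [DecidableEq K]
    (hθ : aeval θ W.twoTorsionPolynomial.toPoly = 0) (h2 : (2 : L) ≠ 0)
    (hne : ∀ x : K, algebraMap K L x - θ ≠ 0) (φ : Lˣ →* ℤˣ) :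
    ∃ χ : W.toAffine.Point →+ Additive ℤˣ, ∀ x y (h : W.toAffine.Nonsingular x y),
      (χ (.some x y h)).toMul = φ (Units.mk0 _ (hne x)) := by
  let f : W.toAffine.Point → Additive ℤˣ := fun P => match P with
    | .zero => 0
    | .some x _ _ => .ofMul (φ (Units.mk0 _ (hne x)))
  have hφ : ∀ u : Lˣ, φ u * φ u = 1 := fun u => Int.units_mul_self _
  refine ⟨⟨⟨f, rfl⟩, ?_⟩, fun x y h => rfl⟩
  rintro (_ | ⟨x₁, y₁, h₁⟩) (_ | ⟨x₂, y₂, h₂⟩)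
  · rfl
  · exact (zero_add (f (.some x₂ y₂ h₂))).symm
  · exact (add_zero (f (.some x₁ y₁ h₁))).symm
  · by_cases hxy : x₁ = x₂ ∧ y₁ = W.toAffine.negY x₂ y₂
    · obtain ⟨rfl, hy⟩ := hxy
      rw [Affine.Point.add_of_Y_eq rfl hy]
      exact (hφ _).symm
    · rw [Affine.Point.add_some hxy]
      obtain ⟨s, hs⟩ := exists_sq_eq_mul_sub_root hθ h₁.1 h₂.1 hxy
      set x₃ := W.toAffine.addX x₁ x₂ (W.toAffine.slope x₁ x₂ y₁ y₂)
      have hs0 : s ≠ 0 := by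
        rintro rfl
        have := mul_ne_zero (mul_ne_zero (mul_ne_zero (hne x₁) (hne x₂)) (hne x₃))
          (pow_ne_zero 2 h2)
        exact this (by rw [hs]; ring)
      have hu : Units.mk0 _ (hne x₁) * Units.mk0 _ (hne x₂) * Units.mk0 _ (hne x₃) *
          Units.mk0 2 h2 ^ 2 = Units.mk0 s hs0 ^ 2 := by
        ext
        simpa using hs
      have h := congrArg φ hu
      simp only [map_mul, map_pow, Int.units_sq, mul_one] at h
      change φ (Units.mk0 _ (hne x₃)) = φ (Units.mk0 _ (hne x₁)) * φ (Units.mk0 _ (hne x₂))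
      rw [mul_eq_one_iff_eq_inv, Int.units_inv_eq_self] at h
      exact h.symm

theorem eq_zero_of_two_nsmul_eq_zero [DecidableEq K]
    (hW : ∀ x : K, W.twoTorsionPolynomial.toPoly.eval x ≠ 0) (P : W.toAffine.Point)
    (hP : 2 • P = 0) : P = 0 := by
  rcases P with _ | ⟨x, y, h⟩
  · rfl
  · by_cases hy : y = W.toAffine.negY x y
    · refine absurd ?_ (hW x)
      have heq := (Affine.equation_iff ..).mp h.1
      simp only [twoTorsionPolynomial, Cubic.toPoly, b₂, b₄, b₆, eval_add, eval_mul, eval_C,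
        eval_pow, eval_X]
      rw [Affine.negY] at hy
      linear_combination (-4 : K) * heq + (2 * y + W.a₁ * x + W.a₃) * hy
    · rw [two_nsmul, Affine.Point.add_self_of_Y_ne hy] at hP
      exact absurd hP (Affine.Point.some_ne_zero _)

end Descent

/-- An integral model has no rational 2-torsion if its 2-torsion polynomial, made monic in the variable `4 x`,
has no root modulo some `q`. -/
theorem eval_twoTorsionPolynomial_ne_zero (V : WeierstrassCurve ℤ) (q : ℕ)
    (hq : ∀ u : ZMod q, u ^ 3 + V.b₂ * u ^ 2 + 8 * V.b₄ * u + 16 * V.b₆ ≠ 0) (x : ℚ) :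
    (V.map (algebraMap ℤ ℚ)).twoTorsionPolynomial.toPoly.eval x ≠ 0 := by
  intro hx
  let F : ℤ[X] := X ^ 3 + C V.b₂ * X ^ 2 + C (8 * V.b₄) * X + C (16 * V.b₆)
  have hF : F.Monic := by unfold F; monicity!
  have hroot : aeval (4 * x) F = 0 := by
    simp only [twoTorsionPolynomial, Cubic.toPoly, map_b₂, map_b₄, map_b₆, eval_add, eval_mul,
      eval_C, eval_pow, eval_X] at hx
    simp only [F, map_add, map_mul, map_pow, aeval_C, aeval_X, map_ofNat]
    linear_combination 16 * hx
  obtain ⟨u, hu⟩ := isInteger_of_is_root_of_monic hF hroot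
  rw [← hu, aeval_algebraMap_apply] at hroot
  have hu0 : aeval u F = 0 := (algebraMap ℤ ℚ).injective_int (by simpa using hroot)
  apply hq u
  have h := congrArg (Int.cast : ℤ → ZMod q) hu0
  simpa [F] using h

section Padic

variable {p : ℕ} [Fact p.Prime]

/-- The angular component of a nonzero `p`-adic number: the residue of its unit part. -/
noncomputable def padicAngularComponent : ℚ_[p]ˣ →* (ZMod p)ˣ :=
  (Units.map (PadicInt.toZMod (p := p)).toMonoidHom).comp <| MonoidHom.mk'
    (fun u => PadicInt.mkUnits (u := (u : ℚ_[p]) * (p : ℚ_[p]) ^ (-(u : ℚ_[p]).valuation)) (by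
      have hp : (p : ℝ) ≠ 0 := mod_cast (Fact.out : p.Prime).ne_zero
      rw [norm_mul, Padic.norm_p_zpow, Padic.norm_eq_zpow_neg_valuation u.ne_zero,
        ← zpow_add₀ hp]
      simp))
    (fun u v => by
      have hp : (p : ℚ_[p]) ≠ 0 := mod_cast (Fact.out : p.Prime).ne_zero
      apply Units.ext
      apply Subtype.ext
      change ((u : ℚ_[p]) * v) * p ^ (-((u : ℚ_[p]) * v).valuation) =
        (u * p ^ (-(u : ℚ_[p]).valuation)) * (v * p ^ (-(v : ℚ_[p]).valuation))
      rw [Padic.valuation_mul u.ne_zero v.ne_zero, neg_add, zpow_add₀ hp]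
      ring)

theorem padicAngularComponent_coe (z : ℤ_[p]) (hz : ‖z‖ = 1) (hz0 : (z : ℚ_[p]) ≠ 0) :
    (padicAngularComponent (Units.mk0 (z : ℚ_[p]) hz0) : ZMod p) = PadicInt.toZMod z := by
  have hv : (z : ℚ_[p]).valuation = 0 := by
    have hp : (1 : ℝ) < p := mod_cast (Fact.out : p.Prime).one_lt
    have h := Padic.norm_eq_zpow_neg_valuation hz0
    rw [PadicInt.padic_norm_e_of_padicInt, hz, eq_comm,
      zpow_eq_one_iff_right₀ (by linarith) hp.ne'] at h
    simpa using h
  change PadicInt.toZMod ⟨(z : ℚ_[p]) * (p : ℚ_[p]) ^ (-(z : ℚ_[p]).valuation), _⟩ = _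
  congr 1
  apply Subtype.ext
  change (z : ℚ_[p]) * (p : ℚ_[p]) ^ (-(z : ℚ_[p]).valuation) = z
  simp [hv]

/-- A simple root modulo `p` of the 2-torsion polynomial of an integral model without rational
2-torsion yields a character of the rational points, given by a Legendre symbol on integral
points. -/
theorem exists_legendre_character (V : WeierstrassCurve ℤ) (t : ℤ)
    (hV : ∀ x : ℚ, (V.map (algebraMap ℤ ℚ)).twoTorsionPolynomial.toPoly.eval x ≠ 0)
    (ht : (p : ℤ) ∣ V.twoTorsionPolynomial.toPoly.eval t)
    (ht' : ¬ (p : ℤ) ∣ V.twoTorsionPolynomial.toPoly.derivative.eval t) :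
    ∃ χ : (V.map (algebraMap ℤ ℚ)).toAffine.Point →+ Additive ℤˣ, ∀ (x : ℤ) (y : ℚ)
      (h : (V.map (algebraMap ℤ ℚ)).toAffine.Nonsingular x y), ¬ (p : ℤ) ∣ x - t →
        ((χ (.some x y h)).toMul : ℤ) = legendreSym p (x - t) := by
  set F := V.twoTorsionPolynomial.toPoly
  have haeval : ∀ G : ℤ[X], aeval (t : ℤ_[p]) G = ((G.eval t : ℤ) : ℤ_[p]) := fun G => by
    simpa using aeval_algebraMap_apply ℤ_[p] t G
  have hder : ‖aeval (t : ℤ_[p]) F.derivative‖ = 1 := by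
    rw [haeval]
    exact le_antisymm (PadicInt.norm_le_one _)
      (not_lt.mp fun h => ht' (PadicInt.norm_intCast_lt_one_iff.mp h))
  obtain ⟨z, hz, hzt, -⟩ := hensels_lemma (F := F) (a := (t : ℤ_[p])) (by
    rw [hder, one_pow, haeval]
    exact PadicInt.norm_intCast_lt_one_iff.mpr ht)
  rw [hder] at hzt
  have hθ : aeval (z : ℚ_[p]) (V.map (algebraMap ℤ ℚ)).twoTorsionPolynomial.toPoly = 0 := by
    simp only [F, twoTorsionPolynomial, Cubic.toPoly, map_add, map_mul, map_pow, aeval_C, aeval_X,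
      map_ofNat] at hz
    have h := congrArg (fun w : ℤ_[p] => (w : ℚ_[p])) hz
    have htwo : ((2 : ℤ_[p]) : ℚ_[p]) = 2 := PadicInt.coe_natCast 2
    have hfour : ((4 : ℤ_[p]) : ℚ_[p]) = 4 := PadicInt.coe_natCast 4
    simpa [twoTorsionPolynomial, Cubic.toPoly, htwo, hfour] using h
  have hne : ∀ x : ℚ, algebraMap ℚ ℚ_[p] x - z ≠ 0 := by
    intro x hx
    rw [← sub_eq_zero.mp hx, aeval_algebraMap_apply] at hθ
    exact hV x (by simpa using hθ)
  obtain ⟨χ, hχ⟩ := exists_descent_character hθ two_ne_zero hne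
    ((quadraticChar (ZMod p)).toUnitHom.comp padicAngularComponent)
  refine ⟨χ, fun x y h hx => ?_⟩
  have hres : PadicInt.toZMod ((x : ℤ_[p]) - z) = ((x - t : ℤ) : ZMod p) := by
    have h0 : PadicInt.toZMod (z - (t : ℤ_[p])) = 0 := by
      rw [← RingHom.mem_ker, PadicInt.ker_toZMod, IsLocalRing.mem_maximalIdeal,
        PadicInt.mem_nonunits]
      exact hzt
    rw [map_sub, sub_eq_zero] at h0
    rw [map_sub, h0]
    simp
  have hnorm : ‖(x : ℤ_[p]) - z‖ = 1 := by
    rw [← PadicInt.isUnit_iff]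
    by_contra hnu
    rw [← mem_nonunits_iff, ← IsLocalRing.mem_maximalIdeal, ← PadicInt.ker_toZMod,
      RingHom.mem_ker, hres, ZMod.intCast_zmod_eq_zero_iff_dvd] at hnu
    exact hx hnu
  have hcoe : algebraMap ℚ ℚ_[p] x - z = (((x : ℤ_[p]) - z : ℤ_[p]) : ℚ_[p]) := by simp
  have hunit : Units.mk0 _ (hne x) = Units.mk0 _ (hcoe ▸ hne x) := Units.ext hcoe
  rw [hχ, hunit, MonoidHom.comp_apply, MulChar.coe_toUnitHom,
    padicAngularComponent_coe _ hnorm, hres, legendreSym]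

end Padic

/-- Integral points are independent if suitable Jacobi symbols separate them. -/
theorem linearIndependent_of_jacobiSym {ι : Type*} [Fintype ι] [DecidableEq ι]
    (V : WeierstrassCurve ℤ)
    (hV : ∀ x : ℚ, (V.map (algebraMap ℤ ℚ)).twoTorsionPolynomial.toPoly.eval x ≠ 0)
    (p : ι → ℕ) (t x : ι → ℤ) (y : ι → ℚ) (hp : ∀ i, (p i).Prime)
    (ht : ∀ i, (p i : ℤ) ∣ V.twoTorsionPolynomial.toPoly.eval (t i))
    (ht' : ∀ i, ¬ (p i : ℤ) ∣ V.twoTorsionPolynomial.toPoly.derivative.eval (t i))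
    (hJ : ∀ i j, jacobiSym (x j - t i) (p i) = if i = j then -1 else 1)
    (hxy : ∀ i, (V.map (algebraMap ℤ ℚ)).toAffine.Nonsingular (x i) (y i)) :
    LinearIndependent ℤ fun i => Affine.Point.some (x i : ℚ) (y i) (hxy i) := by
  have : ∀ i, Fact (p i).Prime := fun i => ⟨hp i⟩
  choose χ hχ using fun i => exists_legendre_character V (t i) hV (ht i) (ht' i)
  refine linearIndependent_int_of_dual_signs χ (fun i j => ?_) (eq_zero_of_two_nsmul_eq_zero hV)
  have hL : legendreSym (p i) (x j - t i) = if i = j then -1 else 1 := by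
    rw [jacobiSym.legendreSym.to_jacobiSym, hJ]
  apply Units.ext
  rw [hχ, hL]
  · split_ifs <;> rfl
  · intro hdvd
    rw [← ZMod.intCast_zmod_eq_zero_iff_dvd, ← legendreSym.eq_zero_iff, hL] at hdvd
    split_ifs at hdvd
    exact one_ne_zero hdvd

/-- The elliptic curve `[1, -1, 0, -106384, 13075804]` has discriminant of absolute value `14 * 249649566346838`,
and its group of rational points contains `8` points that are linearly independent
over `ℤ` (so its Mordell–Weil rank is at least `8`). -/
theorem rank8_low_conductor_curve (W : WeierstrassCurve ℚ)
    (hW : W = ⟨1, -1, 0, -106384, 13075804⟩) :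
    |W.Δ| = 14 * 249649566346838 ∧
      ∃ P : Fin 8 → W.toAffine.Point, LinearIndependent ℤ P := by
  have hΔ : W.Δ = 14 * 249649566346838 := by
    subst hW
    norm_num [WeierstrassCurve.Δ, b₂, b₄, b₆, b₈]
  refine ⟨by rw [hΔ]; norm_num, ?_⟩
  let V : WeierstrassCurve ℤ := ⟨1, -1, 0, -106384, 13075804⟩
  have hWV : W = V.map (algebraMap ℤ ℚ) := by
    rw [hW]
    ext <;> simp [V]
  subst hWV
  let x : Fin 8 → ℤ := ![-375, -374, -370, -361, -348, -342, -319, -284]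
  let y : Fin 8 → ℚ := ![548, 854, 1482, 2263, 2978, 3232, 3964, 4650]
  let p : Fin 8 → ℕ := ![1733, 317, 2927, 241, 1901, 383, 463, 4271]
  let t : Fin 8 → ℤ := ![1156, 29, 541, 230, 1149, 48, 100, 275]
  have hV := eval_twoTorsionPolynomial_ne_zero V 3 (by decide)
  refine ⟨_, linearIndependent_of_jacobiSym V hV p t x y ?_ ?_ ?_ ?_ fun i => ?_⟩
  · intro i
    fin_cases i <;> norm_num [p]
  · intro i
    simp only [twoTorsionPolynomial, Cubic.toPoly, eval_add, eval_mul, eval_C, eval_pow, eval_X]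
    revert i
    decide
  · intro i
    simp only [twoTorsionPolynomial, Cubic.toPoly, derivative_add, derivative_C_mul,
      derivative_X_pow, derivative_X, derivative_C, eval_add, eval_mul, eval_C, eval_pow, eval_X,
      eval_one, eval_zero]
    revert i
    decide
  · intro i j
    fin_cases i <;> fin_cases j <;> simp [p, t, x] <;> norm_num
  · rw [← Affine.equation_iff_nonsingular_of_Δ_ne_zero (by rw [hΔ]; norm_num),
      Affine.equation_iff]
    fin_cases i <;> norm_num [V, x, y]
end

section
/- The elliptic curve over Q given by the Weierstrass equation y^2 + xy = x^3 - x^2 - 135004x + 97151644 (coefficients [a1,a2,a3,a4,a6] = [1,-1,0,-135004,97151644]) has discriminant of absolute value 122 * 32107342006814614, and its group of rational points contains 9 points that are linearly independent over Z (so the curve has Mordell–Weil rank at least 9). -/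
/-- In an abelian group without `2`-torsion, elements that are separated modulo `2` by a family of
subgroups containing all doubles are linearly independent over `ℤ`. -/
theorem linearIndependent_of_separated_mod_two {A ι : Type*} [AddCommGroup A] [Fintype ι]
    (hA : ∀ a : A, a + a = 0 → a = 0) (H : ι → AddSubgroup A) (hH : ∀ i a, a + a ∈ H i)
    (P : ι → A) (hP : ∀ i j, P j ∈ H i ↔ j ≠ i) : LinearIndependent ℤ P := by
  classical
  have even_of_relation (g : ι → ℤ) (hg : ∑ i, g i • P i = 0) (i : ι) : Even (g i) := by
    by_contra hodd
    obtain ⟨k, hk⟩ := Int.not_even_iff_odd.mp hodd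
    have hrest : ∑ j ∈ Finset.univ.erase i, g j • P j ∈ H i :=
      sum_mem fun j hj => zsmul_mem ((hP i j).mpr (Finset.ne_of_mem_erase hj)) _
    rw [← Finset.add_sum_erase _ _ (Finset.mem_univ i)] at hg
    have hmem : g i • P i ∈ H i := by
      rw [eq_neg_of_add_eq_zero_left hg]
      exact neg_mem hrest
    have hsplit : P i = g i • P i - (k • P i + k • P i) := by
      rw [hk]
      module
    exact (hP i i).mp (hsplit ▸ sub_mem hmem (hH i _)) rfl
  have two_pow_dvd (n : ℕ) : ∀ g : ι → ℤ, ∑ i, g i • P i = 0 → ∀ i, (2 : ℤ) ^ n ∣ g i := by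
    induction n with
    | zero => simp
    | succ n ih =>
      intro g hg i
      choose f hf using even_of_relation g hg
      have hrel : ∑ i, f i • P i = 0 := by
        apply hA
        simpa only [hf, add_smul, Finset.sum_add_distrib] using hg
      obtain ⟨c, hc⟩ := ih f hrel i
      exact ⟨c, by rw [hf, hc]; ring⟩
  refine Fintype.linearIndependent_iff.mpr fun g hg i => ?_
  refine Int.eq_zero_of_abs_lt_dvd (two_pow_dvd (g i).natAbs g hg i) ?_
  rw [Int.abs_eq_natAbs]
  exact_mod_cast Nat.lt_two_pow_self

namespace WeierstrassCurve.Affine.Point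

variable {F K : Type*} [Field F] [Field K] [Algebra F K] {W : WeierstrassCurve F}

/-- The polynomial `4X³ + b₂X² + 2b₄X + b₆`, whose roots are the `x`-coordinates of the points of
order two, vanishes at no element of the base field. -/
def NoTwoTorsion (W : WeierstrassCurve F) : Prop :=
  ∀ x : F, 4 * x ^ 3 + W.b₂ * x ^ 2 + 2 * W.b₄ * x + W.b₆ ≠ 0

theorem eq_zero_of_add_self_eq_zero [DecidableEq F] (hW : NoTwoTorsion W) (P : W.toAffine.Point)
    (hP : P + P = 0) : P = 0 := by
  rcases P with _ | ⟨x, y, h⟩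
  · rfl
  · have hneg := add_eq_zero_iff_eq_neg.mp hP
    rw [neg_some, some.injEq] at hneg
    have hy := hneg.2
    have heq := (equation_iff ..).mp h.1
    refine absurd ?_ (hW x)
    simp only [negY, b₂, b₄, b₆] at hy ⊢
    linear_combination -4 * heq + (2 * y + W.a₁ * x + W.a₃) * hy

/-- The value `x(P) - e` of the `2`-descent map attached to a root `e` of the `2`-division
polynomial. -/
def descentValue (e : K) : W.toAffine.Point → K
  | zero => 1
  | some x _ _ => algebraMap F K x - e

theorem descentValue_zero (e : K) : descentValue e (0 : W.toAffine.Point) = 1 := rfl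

theorem descentValue_neg (e : K) (P : W.toAffine.Point) :
    descentValue e (-P) = descentValue e P := by
  rcases P with _ | ⟨x, y, h⟩ <;> rfl

section Root

variable {e : K} (he : 4 * e ^ 3 + algebraMap F K W.b₂ * e ^ 2 + 2 * algebraMap F K W.b₄ * e +
  algebraMap F K W.b₆ = 0)

include he

theorem descentValue_ne_zero (hW : NoTwoTorsion W) (P : W.toAffine.Point) :
    descentValue e P ≠ 0 := by
  rcases P with _ | ⟨x, y, h⟩
  · exact one_ne_zero
  · intro hx
    obtain rfl : algebraMap F K x = e := sub_eq_zero.mp hx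
    apply hW x
    apply (algebraMap F K).injective
    simpa [map_ofNat] using he

theorem isSquare_descentValue_add_mul [DecidableEq F] (h2 : (2 : K) ≠ 0) (P Q : W.toAffine.Point) :
    IsSquare (descentValue e (P + Q) * (descentValue e P * descentValue e Q)) := by
  rcases P with _ | ⟨x₁, y₁, h₁⟩
  · rw [← zero_def, zero_add, descentValue_zero, one_mul]
    exact ⟨_, rfl⟩
  rcases Q with _ | ⟨x₂, y₂, h₂⟩
  · rw [← zero_def, add_zero, descentValue_zero, mul_one]
    exact ⟨_, rfl⟩
  by_cases hxy : x₁ = x₂ ∧ y₁ = W.toAffine.negY x₂ y₂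
  · rw [add_of_Y_eq hxy.1 hxy.2, descentValue_zero, one_mul]
    obtain rfl := hxy.1
    exact ⟨_, rfl⟩
  · have hline := congrArg (Polynomial.aeval e) (addPolynomial_slope h₁.1 h₂.1 hxy)
    rw [add_some hxy]
    simp only [descentValue]
    generalize W.toAffine.slope x₁ x₂ y₁ y₂ = l at hline ⊢
    generalize W.toAffine.addX x₁ x₂ l = x₃ at hline ⊢
    simp only [addPolynomial_eq, Cubic.toPoly, b₂, b₄, b₆, map_neg, map_add, map_mul, map_pow,
      map_sub, map_ofNat, map_one, Polynomial.aeval_C, Polynomial.aeval_X] at hline he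
    refine ⟨(2 * (algebraMap F K l * (e - algebraMap F K x₁) + algebraMap F K y₁) +
      algebraMap F K W.a₁ * e + algebraMap F K W.a₃) / 2, ?_⟩
    field_simp
    linear_combination -4 * hline - he

/-- The points on which the `2`-descent map attached to the root `e` is a square. -/
def descentKernel [DecidableEq F] (h2 : (2 : K) ≠ 0) (hW : NoTwoTorsion W) :
    AddSubgroup W.toAffine.Point where
  carrier := {P | IsSquare (descentValue e P)}
  zero_mem' := ⟨1, (mul_one 1).symm⟩
  add_mem' {P Q} hP hQ := by
    have hne := mul_ne_zero (descentValue_ne_zero he hW P) (descentValue_ne_zero he hW Q)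
    have hdiv := (isSquare_descentValue_add_mul he h2 P Q).div (hP.mul hQ)
    rwa [mul_div_cancel_right₀ _ hne] at hdiv
  neg_mem' {P} hP := by
    rwa [Set.mem_ofPred_eq, descentValue_neg]

theorem mem_descentKernel [DecidableEq F] (h2 : (2 : K) ≠ 0) (hW : NoTwoTorsion W)
    (P : W.toAffine.Point) : P ∈ descentKernel he h2 hW ↔ IsSquare (descentValue e P) := Iff.rfl

theorem add_self_mem_descentKernel [DecidableEq F] (h2 : (2 : K) ≠ 0) (hW : NoTwoTorsion W)
    (P : W.toAffine.Point) : P + P ∈ descentKernel he h2 hW := by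
  have hne := mul_ne_zero (descentValue_ne_zero he hW P) (descentValue_ne_zero he hW P)
  have hdiv := (isSquare_descentValue_add_mul he h2 P P).div ⟨descentValue e P, rfl⟩
  rwa [mul_div_cancel_right₀ _ hne] at hdiv

end Root

end WeierstrassCurve.Affine.Point

namespace PadicInt

open Polynomial

variable {p : ℕ} [Fact p.Prime]

theorem norm_lt_one_iff_toZMod_eq_zero (z : ℤ_[p]) : ‖z‖ < 1 ↔ toZMod z = 0 := by
  rw [← mem_nonunits, ← IsLocalRing.mem_maximalIdeal, ← ker_toZMod, RingHom.mem_ker]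

theorem norm_eq_one_iff_toZMod_ne_zero (z : ℤ_[p]) : ‖z‖ = 1 ↔ toZMod z ≠ 0 := by
  rw [Ne, ← norm_lt_one_iff_toZMod_eq_zero, not_lt]
  exact ⟨ge_of_eq, (norm_le_one z).antisymm⟩

theorem exists_root_of_simple_root_toZMod (f : ℤ_[p][X]) (a : ℤ_[p])
    (hroot : toZMod (f.eval a) = 0) (hsimple : toZMod (f.derivative.eval a) ≠ 0) :
    ∃ z : ℤ_[p], f.eval z = 0 ∧ toZMod z = toZMod a := by
  have hderiv := (norm_eq_one_iff_toZMod_ne_zero _).mpr hsimple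
  obtain ⟨z, hz, hza, -⟩ := hensels_lemma (F := f) (a := a) (by
    simpa only [coe_aeval_eq_eval, hderiv, one_pow, norm_lt_one_iff_toZMod_eq_zero] using hroot)
  rw [coe_aeval_eq_eval, hderiv, norm_lt_one_iff_toZMod_eq_zero, map_sub, sub_eq_zero] at hza
  exact ⟨z, hz, hza⟩

theorem isSquare_coe_iff_isSquare_toZMod (hp : (2 : ZMod p) ≠ 0) (u : ℤ_[p])
    (hu : toZMod u ≠ 0) : IsSquare (u : ℚ_[p]) ↔ IsSquare (toZMod u) := by
  constructor
  · rintro ⟨s, hs⟩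
    have hnorm : ‖s‖ ≤ 1 := by
      have hsq : ‖s‖ * ‖s‖ ≤ 1 := by
        rw [← norm_mul, ← hs]
        exact norm_le_one u
      nlinarith [norm_nonneg s]
    have hu' : IsSquare u := ⟨⟨s, hnorm⟩, Subtype.ext hs⟩
    exact hu'.map toZMod
  · rintro ⟨r, hr⟩
    obtain ⟨a, rfl⟩ := ZMod.ringHom_surjective (toZMod : ℤ_[p] →+* ZMod p) r
    have ha : toZMod a ≠ 0 := by
      rintro ha
      simp [hr, ha] at hu
    obtain ⟨z, hz, -⟩ := exists_root_of_simple_root_toZMod (X ^ 2 - C u) a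
      (by simp [hr, pow_two]) (by simpa [map_ofNat, one_add_one_eq_two] using ⟨hp, ha⟩)
    refine ⟨z, ?_⟩
    rw [eval_sub, eval_pow, eval_X, eval_C, sub_eq_zero, pow_two] at hz
    rw [← hz, PadicInt.coe_mul]

end PadicInt

open WeierstrassCurve.Affine.Point in
/-- At a simple root `c` modulo `p` of the `2`-division polynomial there is a subgroup containing
all doubles in which membership of integral points is decided by the Legendre symbol of `x - c`. -/
theorem exists_descent_subgroup_of_simple_root_mod (W : WeierstrassCurve ℚ)
    (hW : NoTwoTorsion W) (p : ℕ) [Fact p.Prime] (b₂ b₄ b₆ c : ℤ)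
    (hb₂ : W.b₂ = b₂) (hb₄ : W.b₄ = b₄) (hb₆ : W.b₆ = b₆) (hp : ¬ (p : ℤ) ∣ 2)
    (hroot : (p : ℤ) ∣ 4 * c ^ 3 + b₂ * c ^ 2 + 2 * b₄ * c + b₆)
    (hsimple : ¬ (p : ℤ) ∣ 12 * c ^ 2 + 2 * b₂ * c + 2 * b₄) :
    ∃ H : AddSubgroup W.toAffine.Point, (∀ P, P + P ∈ H) ∧
      ∀ (n : ℤ) (x y : ℚ) (h : W.toAffine.Nonsingular x y), x = n → legendreSym p (n - c) ≠ 0 →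
        (some x y h ∈ H ↔ legendreSym p (n - c) = 1) := by
  rw [← ZMod.intCast_zmod_eq_zero_iff_dvd] at hp hroot hsimple
  push_cast at hp hroot hsimple
  obtain ⟨e, he, hec⟩ := PadicInt.exists_root_of_simple_root_toZMod
    (4 * Polynomial.X ^ 3 + Polynomial.C (b₂ : ℤ_[p]) * Polynomial.X ^ 2 +
      Polynomial.C (2 * b₄ : ℤ_[p]) * Polynomial.X + Polynomial.C (b₆ : ℤ_[p])) c
    (by simpa [map_ofNat] using hroot)
    (by
      convert! hsimple using 1
      simp [map_ofNat]
      ring)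
  have he' : 4 * (e : ℚ_[p]) ^ 3 + algebraMap ℚ ℚ_[p] W.b₂ * (e : ℚ_[p]) ^ 2 +
      2 * algebraMap ℚ ℚ_[p] W.b₄ * (e : ℚ_[p]) + algebraMap ℚ ℚ_[p] W.b₆ = 0 := by
    simp only [hb₂, hb₄, hb₆, map_intCast]
    have hcoe := congrArg PadicInt.Coe.ringHom he
    simp only [Polynomial.eval_add, Polynomial.eval_mul, Polynomial.eval_pow, Polynomial.eval_X,
      Polynomial.eval_ofNat, Polynomial.eval_intCast, map_add, map_mul, map_pow, map_ofNat,
      map_intCast, _root_.map_zero] at hcoe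
    exact hcoe
  refine ⟨descentKernel he' two_ne_zero hW, add_self_mem_descentKernel he' _ hW, ?_⟩
  rintro n x y h rfl hne
  have hne' : ((n - c : ℤ) : ZMod p) ≠ 0 := fun h0 => hne ((legendreSym.eq_zero_iff p _).mpr h0)
  have hred : PadicInt.toZMod ((n : ℤ_[p]) - e) = ((n - c : ℤ) : ZMod p) := by
    simp [hec]
  have hval : descentValue (e : ℚ_[p]) (some (n : ℚ) y h) =
      (((n : ℤ_[p]) - e : ℤ_[p]) : ℚ_[p]) := by
    simp [descentValue]
  rw [mem_descentKernel, hval, PadicInt.isSquare_coe_iff_isSquare_toZMod hp _ (hred ▸ hne'), hred,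
    legendreSym.eq_one_iff p hne']

/-- The elliptic curve `[1, -1, 0, -135004, 97151644]` has discriminant of absolute value `122 * 32107342006814614`,
and its group of rational points contains `9` points that are linearly independent
over `ℤ` (so its Mordell–Weil rank is at least `9`). -/
theorem rank9_low_conductor_curve (W : WeierstrassCurve ℚ)
    (hW : W = ⟨1, -1, 0, -135004, 97151644⟩) :
    |W.Δ| = 122 * 32107342006814614 ∧
      ∃ P : Fin 9 → W.toAffine.Point, LinearIndependent ℤ P := by
  have hb₂ : W.b₂ = (-3 : ℤ) := by subst hW; norm_num [WeierstrassCurve.b₂]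
  have hb₄ : W.b₄ = (-270008 : ℤ) := by subst hW; norm_num [WeierstrassCurve.b₄]
  have hb₆ : W.b₆ = (388606576 : ℤ) := by subst hW; norm_num [WeierstrassCurve.b₆]
  have hΔ : W.Δ = -(122 * 32107342006814614) := by
    subst hW
    norm_num [WeierstrassCurve.Δ, WeierstrassCurve.b₂, WeierstrassCurve.b₄, WeierstrassCurve.b₆,
      WeierstrassCurve.b₈]
  refine ⟨by rw [hΔ]; norm_num, ?_⟩
  have htors : WeierstrassCurve.Affine.Point.NoTwoTorsion W := by
    intro x hx
    rw [hb₂, hb₄, hb₆] at hx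
    push_cast at hx
    have hcop := x.reduced
    have hint : 4 * x.num ^ 3 - 3 * x.num ^ 2 * x.den - 540016 * x.num * x.den ^ 2 +
        388606576 * (x.den : ℤ) ^ 3 = 0 := by
      have hden : (x.den : ℚ) ≠ 0 := by exact_mod_cast x.den_ne_zero
      rw [← Rat.num_div_den x] at hx
      field_simp at hx
      have : (4 * x.num ^ 3 - 3 * x.num ^ 2 * x.den - 540016 * x.num * x.den ^ 2 +
        388606576 * (x.den : ℚ) ^ 3) = 0 := by linear_combination hx
      exact_mod_cast this
    have hmod := congrArg (Int.cast : ℤ → ZMod 3) hint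
    push_cast at hmod
    have hno : ∀ n d : ZMod 3, 4 * n ^ 3 - 3 * n ^ 2 * d - 540016 * n * d ^ 2 +
        388606576 * d ^ 3 = 0 → n = 0 ∧ d = 0 := by decide
    obtain ⟨hn, hd⟩ := hno _ _ hmod
    rw [ZMod.intCast_zmod_eq_zero_iff_dvd] at hn
    rw [ZMod.natCast_eq_zero_iff] at hd
    have := Nat.dvd_gcd (Int.natCast_dvd.mp hn) hd
    rw [hcop] at this
    omega
  let x : Fin 9 → ℤ := ![-25, -45, 60, 70, -79, 94, -113, -142, -172]
  let y : Fin 9 → ℚ := ![10038, 10178, 9418, 9348, 10399, 9188, 10590, 10722, 10822]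
  have hns (i : Fin 9) : W.toAffine.Nonsingular (x i : ℚ) (y i) := by
    have hΔ0 : W.Δ ≠ 0 := by rw [hΔ]; norm_num
    refine (WeierstrassCurve.Affine.equation_iff_nonsingular_of_Δ_ne_zero hΔ0).mp ?_
    rw [WeierstrassCurve.Affine.equation_iff, hW]
    fin_cases i <;> norm_num [x, y]
  let p : Fin 9 → ℕ := ![1973, 337, 823, 11489, 2309, 263, 1039, 6121, 12641]
  let c : Fin 9 → ℤ := ![969, 69, 13, 343, 56, 52, 769, 4098, 2764]
  have hp (i : Fin 9) : Fact (p i).Prime := ⟨by fin_cases i <;> norm_num [p]⟩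
  have hsym (i j : Fin 9) : legendreSym (p i) (x j - c i) = if j = i then -1 else 1 := by
    fin_cases i <;> fin_cases j <;> norm_num [p, x, c]
  have hH (i : Fin 9) := exists_descent_subgroup_of_simple_root_mod W htors (p i)
    (-3) (-270008) 388606576 (c i) hb₂ hb₄ hb₆
    (by fin_cases i <;> norm_num [p]) (by fin_cases i <;> norm_num [p, c])
    (by fin_cases i <;> norm_num [p, c])
  choose H hdouble hmem using hH
  refine ⟨fun i => .some (x i : ℚ) (y i) (hns i), linearIndependent_of_separated_mod_two
    (WeierstrassCurve.Affine.Point.eq_zero_of_add_self_eq_zero htors) H hdouble _ fun i j => ?_⟩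
  have hij := hsym i j
  rw [hmem i (x j) _ _ (hns j) rfl (by rw [hij]; split_ifs <;> decide), hij]
  by_cases h : j = i <;> simp [h]
end

section
/- The elliptic curve over Q given by the Weierstrass equation y^2 + y = x^3 - 16359067x + 26274178986 (coefficients [a1,a2,a3,a4,a6] = [0,0,1,-16359067,26274178986]) has discriminant of absolute value 18031737725935636520843, this integer is prime, and the curve's group of rational points contains 11 points that are linearly independent over Z (so the curve has Mordell–Weil rank at least 11). -/
theorem Nat.prime_of_lucas_of_list {p : ℕ} (a : ZMod p) (L : List ℕ)
    (hL : ∀ q ∈ L, q.Prime) (hprod : L.prod = p - 1) (ha : a ^ (p - 1) = 1)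
    (hd : ∀ q ∈ L, a ^ ((p - 1) / q) ≠ 1) : p.Prime :=
  lucas_primality p a ha fun q hq hqp ↦
    hd q <| mem_list_primes_of_dvd_prod hq.prime (fun r hr ↦ (hL r hr).prime) (hprod ▸ hqp)

theorem prime_1523126289712399 : Nat.Prime 1523126289712399 := by
  refine Nat.prime_of_lucas_of_list 6 [2, 3, 7, 53, 193, 40093, 88427] ?_ (by norm_num) ?_ ?_
  · norm_num
  · norm_num only
    reduce_mod_char
  · norm_num only [List.forall_mem_cons, List.not_mem_nil]
    refine ⟨?_, ?_, ?_, ?_, ?_, ?_, ?_, by simp⟩ <;> reduce_mod_char <;> decide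

theorem prime_246746458933408639 : Nat.Prime 246746458933408639 := by
  refine Nat.prime_of_lucas_of_list 3 [2, 3, 3, 3, 3, 1523126289712399] ?_ (by norm_num) ?_ ?_
  · simp only [List.forall_mem_cons, prime_1523126289712399]
    norm_num
  · norm_num only
    reduce_mod_char
  · norm_num only [List.forall_mem_cons, List.not_mem_nil]
    refine ⟨?_, ?_, ?_, ?_, ?_, ?_, by simp⟩ <;> reduce_mod_char <;> decide

theorem prime_18031737725935636520843 : Nat.Prime 18031737725935636520843 := by
  refine Nat.prime_of_lucas_of_list 2 [2, 61, 599, 246746458933408639] ?_ (by norm_num) ?_ ?_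
  · simp only [List.forall_mem_cons, prime_246746458933408639]
    norm_num
  · norm_num only
    reduce_mod_char
  · norm_num only [List.forall_mem_cons, List.not_mem_nil]
    refine ⟨?_, ?_, ?_, ?_, by simp⟩ <;> reduce_mod_char <;> decide

theorem linearIndependent_int_of_exponent_two {ι A B : Type*} [Fintype ι] [AddCommGroup A]
    [AddCommGroup B] (hA : ∀ a : A, 2 • a = 0 → a = 0) (hB : ∀ b : B, 2 • b = 0) (P : ι → A)
    (φ : ι → A →+ B) (hφ : ∀ i j, φ i (P j) = 0 ↔ i ≠ j) : LinearIndependent ℤ P := by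
  have even (c : ι → ℤ) (hc : ∑ j, c j • P j = 0) (i : ι) : 2 ∣ c i := by
    have h := congrArg (φ i) hc
    rw [map_sum, map_zero, Finset.sum_eq_single i
      (fun j _ hj ↦ by rw [map_zsmul, (hφ i j).2 hj.symm, smul_zero]) (by simp), map_zsmul] at h
    by_contra hodd
    obtain ⟨k, hk⟩ := Int.not_even_iff_odd.1 (mt even_iff_two_dvd.1 hodd)
    refine (hφ i i).not.2 (by simp) ?_
    rwa [hk, add_smul, one_smul, mul_comm, mul_smul, two_smul, ← two_nsmul, hB, smul_zero,
      zero_add] at h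
  have pow_dvd (n : ℕ) : ∀ c : ι → ℤ, ∑ j, c j • P j = 0 → ∀ i, 2 ^ n ∣ c i := by
    induction n with
    | zero => simp
    | succ n ih =>
      intro c hc i
      choose d hd using even c hc
      rw [hd i, pow_succ']
      refine mul_dvd_mul_left 2 (ih d (hA _ ?_) i)
      rw [← hc, Finset.smul_sum]
      refine Finset.sum_congr rfl fun j _ ↦ ?_
      rw [hd j, mul_smul, two_zsmul, two_nsmul]
  refine Fintype.linearIndependent_iff.2 fun c hc i ↦ ?_
  refine Int.eq_zero_of_abs_lt_dvd (pow_dvd (c i).natAbs c hc i) ?_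
  rw [Int.abs_eq_natAbs]
  exact_mod_cast Nat.lt_two_pow_self

namespace WeierstrassCurve.Affine

open Polynomial

section Descent

variable {F K : Type*} [Field F] [Field K] [Algebra F K] {W : Affine F} {t : K}

/-- The function `P ↦ x(P) - t` on affine points, extended by `1` at infinity. -/
def Point.xSub (t : K) : W.Point → K
  | .zero => 1
  | .some x _ _ => algebraMap F K x - t

theorem Point.xSub_ne_zero (h_irr : ∀ x : F, algebraMap F K x ≠ t) (P : W.Point) :
    P.xSub t ≠ 0 := by
  rcases P with _ | ⟨x, y, h⟩
  · exact one_ne_zero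
  · exact sub_ne_zero.2 (h_irr x)

variable [DecidableEq F]

theorem Point.isSquare_xSub_mul_xSub_mul_xSub_add (h_two : (2 : K) ≠ 0)
    (ht : aeval t W.twoTorsionPolynomial.toPoly = 0) (P Q : W.Point) :
    IsSquare (P.xSub t * Q.xSub t * (P + Q).xSub t) := by
  rcases P with _ | ⟨x₁, y₁, h₁⟩
  · rw [← zero_def, zero_add]
    exact ⟨Q.xSub t, by simp [xSub]⟩
  rcases Q with _ | ⟨x₂, y₂, h₂⟩
  · rw [← zero_def, add_zero]
    exact ⟨algebraMap F K x₁ - t, by simp [xSub]⟩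
  by_cases hxy : x₁ = x₂ ∧ y₁ = W.negY x₂ y₂
  · rw [add_of_Y_eq hxy.1 hxy.2]
    exact ⟨algebraMap F K x₁ - t, by simp [xSub, hxy.1]⟩
  rw [add_some hxy]
  set ℓ := W.slope x₁ x₂ y₁ y₂
  have key := congrArg (aeval t) (addPolynomial_slope h₁.1 h₂.1 hxy)
  simp only [addPolynomial_eq, twoTorsionPolynomial, Cubic.toPoly, b₂, b₄, b₆, map_add,
    map_mul, map_sub, map_neg, map_pow, map_one, aeval_X, aeval_C, map_ofNat] at key ht
  refine ⟨(2 * (algebraMap F K ℓ * (t - algebraMap F K x₁) + algebraMap F K y₁) +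
    algebraMap F K W.a₁ * t + algebraMap F K W.a₃) / 2, ?_⟩
  simp only [xSub]
  field_simp
  linear_combination -ht - 4 * key

/-- The composite of the descent map `P ↦ x(P) - t` with a quadratic character of `K`, for `t` a
root of the two-torsion polynomial. -/
noncomputable def Point.descentHom (h_two : (2 : K) ≠ 0)
    (ht : aeval t W.twoTorsionPolynomial.toPoly = 0) (h_irr : ∀ x : F, algebraMap F K x ≠ t)
    (χ : Kˣ →* ℤˣ) : W.Point →+ Additive ℤˣ :=
  .mk' (fun P ↦ .ofMul (χ (Units.mk0 _ (P.xSub_ne_zero h_irr)))) fun P Q ↦ by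
    obtain ⟨s, hs⟩ := Point.isSquare_xSub_mul_xSub_mul_xSub_add h_two ht P Q
    have hs0 : s ≠ 0 := by
      rintro rfl
      rw [mul_zero] at hs
      exact mul_ne_zero (mul_ne_zero (P.xSub_ne_zero h_irr) (Q.xSub_ne_zero h_irr))
        ((P + Q).xSub_ne_zero h_irr) hs
    have h : Units.mk0 _ (P.xSub_ne_zero h_irr) * Units.mk0 _ (Q.xSub_ne_zero h_irr) *
        Units.mk0 _ ((P + Q).xSub_ne_zero h_irr) = Units.mk0 s hs0 * Units.mk0 s hs0 :=
      Units.ext hs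
    have h' := congrArg χ h
    rw [map_mul, map_mul, map_mul, Int.units_mul_self] at h'
    rw [← ofMul_mul, eq_inv_of_mul_eq_one_left h', Int.units_inv_eq_self]

end Descent

/-- There are no points of order two when the two-torsion polynomial has no root. -/
theorem Point.eq_zero_of_two_nsmul_eq_zero {F : Type*} [Field F] [DecidableEq F] {W : Affine F}
    (h : ∀ x : F, W.twoTorsionPolynomial.toPoly.eval x ≠ 0) {P : W.Point} (hP : 2 • P = 0) :
    P = 0 := by
  rcases P with _ | ⟨x, y, hxy⟩
  · rfl
  rw [two_nsmul] at hP
  by_cases hy : y = W.negY x y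
  · refine absurd ?_ (h x)
    have h1 := (equation_iff _ _).1 hxy.1
    rw [negY] at hy
    simp only [twoTorsionPolynomial, Cubic.toPoly, b₂, b₄, b₆, eval_add, eval_mul, eval_C,
      eval_pow, eval_X]
    linear_combination (2 * y + W.a₁ * x + W.a₃) * hy - 4 * h1
  · rw [add_self_of_Y_ne hy] at hP
    exact absurd hP (some_ne_zero _)

end WeierstrassCurve.Affine

namespace Padic

variable {p : ℕ} [Fact p.Prime]

theorem norm_mul_zpow_neg_valuation_le_one (x : ℚ_[p]) :
    ‖x * (p : ℚ_[p]) ^ (-x.valuation)‖ ≤ 1 := by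
  rcases eq_or_ne x 0 with rfl | hx
  · simp
  · have hp : (p : ℝ) ≠ 0 := by exact_mod_cast (Fact.out : p.Prime).ne_zero
    rw [norm_mul, norm_eq_zpow_neg_valuation hx, norm_p_zpow, neg_neg, ← zpow_add₀ hp]
    simp

/-- The Legendre symbol of the unit part of a `p`-adic number. -/
noncomputable def quadraticCharUnitPart (p : ℕ) [Fact p.Prime] : ℚ_[p] →* ℤ where
  toFun x := quadraticChar (ZMod p)
    (PadicInt.toZMod ⟨x * (p : ℚ_[p]) ^ (-x.valuation), norm_mul_zpow_neg_valuation_le_one x⟩)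
  map_one' := by
    simp only [valuation_one, neg_zero, zpow_zero, mul_one]
    exact (congrArg _ (map_one _)).trans (map_one _)
  map_mul' x y := by
    refine Eq.trans (congrArg _ (congrArg _ ?_))
      ((congrArg _ (map_mul _ _ _)).trans (map_mul _ _ _))
    refine Subtype.ext ?_
    change _ = x * (p : ℚ_[p]) ^ (-x.valuation) * (y * (p : ℚ_[p]) ^ (-y.valuation))
    have hp : (p : ℚ_[p]) ≠ 0 := by exact_mod_cast (Fact.out : p.Prime).ne_zero
    rcases eq_or_ne x 0 with rfl | hx
    · simp
    rcases eq_or_ne y 0 with rfl | hy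
    · simp
    change x * y * (p : ℚ_[p]) ^ (-(x * y).valuation) = _
    rw [valuation_mul hx hy, neg_add, zpow_add₀ hp]
    ring

theorem quadraticCharUnitPart_coe {z : ℤ_[p]} (hz : PadicInt.toZMod z ≠ 0) :
    quadraticCharUnitPart p z = quadraticChar (ZMod p) (PadicInt.toZMod z) := by
  have hu : IsUnit z := by
    rw [← IsLocalRing.notMem_maximalIdeal, ← PadicInt.ker_toZMod]
    exact hz
  have hz0 : (z : ℚ_[p]).valuation = 0 := by
    have h1 : ‖(z : ℚ_[p])‖ = 1 := PadicInt.isUnit_iff.1 hu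
    have h0 : (z : ℚ_[p]) ≠ 0 := norm_ne_zero_iff.1 (h1.trans_ne one_ne_zero)
    rw [norm_eq_zpow_neg_valuation h0, zpow_eq_one_iff_right₀ (by positivity)
      (by exact_mod_cast (Fact.out : p.Prime).ne_one)] at h1
    omega
  change quadraticChar (ZMod p)
    (PadicInt.toZMod ⟨z * (p : ℚ_[p]) ^ (-(z : ℚ_[p]).valuation), _⟩) = _
  congr 2
  exact Subtype.ext (by simp [hz0])

end Padic

theorem PadicInt.exists_root_of_simple_root_mod {p : ℕ} [Fact p.Prime] (f : Polynomial ℤ) {a : ℤ}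
    (h : (p : ℤ) ∣ f.eval a) (h' : ¬ (p : ℤ) ∣ f.derivative.eval a) :
    ∃ z : ℤ_[p], f.aeval z = 0 ∧ toZMod z = a := by
  have coe (g : Polynomial ℤ) : g.aeval (a : ℤ_[p]) = (g.eval a : ℤ) := by
    exact Polynomial.aeval_algebraMap_apply_eq_algebraMap_eval a g
  have hd : ‖f.derivative.aeval (a : ℤ_[p])‖ = 1 := by
    rw [coe]
    exact (norm_le_one _).eq_of_not_lt (mt (norm_int_lt_one_iff_dvd _).1 h')
  obtain ⟨z, hz, hza, -⟩ := hensels_lemma (F := f) (a := (a : ℤ_[p])) <| by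
    rw [hd, one_pow, coe]
    exact (norm_int_lt_one_iff_dvd _).2 h
  refine ⟨z, hz, ?_⟩
  rw [hd, ← mem_nonunits, ← IsLocalRing.mem_maximalIdeal, ← ker_toZMod, RingHom.mem_ker,
    map_sub, map_intCast, sub_eq_zero] at hza
  exact hza

open Polynomial in
/-- Reduction of the descent map at a prime `p` for which the two-torsion polynomial has a simple
root `a` modulo `p`. -/
theorem WeierstrassCurve.exists_hom_eq_legendreSym (W : WeierstrassCurve ℤ)
    (h_irr : ∀ x : ℚ, aeval x W.twoTorsionPolynomial.toPoly ≠ 0) (p : ℕ) [Fact p.Prime] {a : ℤ}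
    (h : (p : ℤ) ∣ W.twoTorsionPolynomial.toPoly.eval a)
    (h' : ¬ (p : ℤ) ∣ W.twoTorsionPolynomial.toPoly.derivative.eval a) :
    ∃ φ : (W.map (Int.castRingHom ℚ)).toAffine.Point →+ Additive ℤˣ,
      ∀ (x y : ℤ) (hxy : (W.map (Int.castRingHom ℚ)).toAffine.Nonsingular x y),
        legendreSym p (x - a) ≠ 0 → ((φ (.some x y hxy)).toMul : ℤ) = legendreSym p (x - a) := by
  obtain ⟨z, hz, hza⟩ := PadicInt.exists_root_of_simple_root_mod _ h h'
  have ht : aeval (z : ℚ_[p]) W.twoTorsionPolynomial.toPoly = 0 := by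
    have := aeval_algebraMap_apply ℚ_[p] z W.twoTorsionPolynomial.toPoly
    rwa [hz, map_zero] at this
  have h_map : (W.map (Int.castRingHom ℚ)).twoTorsionPolynomial.toPoly =
      W.twoTorsionPolynomial.toPoly.map (algebraMap ℤ ℚ) := by
    simp [twoTorsionPolynomial, Cubic.toPoly, map_ofNat]
  have h_ne (x : ℚ) : algebraMap ℚ ℚ_[p] x ≠ z := by
    rintro hx
    rw [← hx, aeval_algebraMap_apply, map_eq_zero] at ht
    exact h_irr x ht
  refine ⟨Affine.Point.descentHom two_ne_zero (t := (z : ℚ_[p])) ?_ h_ne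
    (Units.map (Padic.quadraticCharUnitPart p)), fun x y hxy hx ↦ ?_⟩
  · change aeval _ (W.map (Int.castRingHom ℚ)).twoTorsionPolynomial.toPoly = 0
    rw [h_map, aeval_map_algebraMap, ht]
  · have hmod : PadicInt.toZMod ((x : ℤ_[p]) - z) = ((x - a : ℤ) : ZMod p) := by
      rw [map_sub, map_intCast, hza, Int.cast_sub]
    have hcoe : algebraMap ℚ ℚ_[p] x - z = ((x - z : ℤ_[p]) : ℚ_[p]) := by simp
    change Padic.quadraticCharUnitPart p (algebraMap ℚ ℚ_[p] x - z) = _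
    rw [hcoe, Padic.quadraticCharUnitPart_coe, hmod, legendreSym]
    rw [hmod]
    exact fun h0 ↦ hx (by rw [legendreSym, h0, MulChar.map_zero])

/-- The integral model of the curve `y² + y = x³ - 16359067x + 26274178986`. -/
def integralModel : WeierstrassCurve ℤ := ⟨0, 0, 1, -16359067, 26274178986⟩

open Polynomial in
theorem integralModel_aeval_twoTorsionPolynomial_ne_zero (x : ℚ) :
    aeval x integralModel.twoTorsionPolynomial.toPoly ≠ 0 := by
  intro h
  have h_mod : ∀ m n : ZMod 3, 4 * m ^ 3 - 65436268 * m * n ^ 2 + 105096715945 * n ^ 3 = 0 →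
      m = 0 ∧ n = 0 := by decide
  have hx : 4 * x.num ^ 3 - 65436268 * x.num * (x.den : ℤ) ^ 2 + 105096715945 * (x.den : ℤ) ^ 3
      = 0 := by
    have hd : (x.den : ℚ) ≠ 0 := by exact_mod_cast x.den_ne_zero
    have hq : 4 * x ^ 3 - 65436268 * x + 105096715945 = 0 := by
      simp [integralModel, WeierstrassCurve.twoTorsionPolynomial, Cubic.toPoly,
        WeierstrassCurve.b₂, WeierstrassCurve.b₄, WeierstrassCurve.b₆, map_ofNat] at h
      linear_combination h
    rw [← Rat.num_div_den x] at hq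
    field_simp at hq
    have : (4 * x.num ^ 3 - 65436268 * x.num * (x.den : ℚ) ^ 2 + 105096715945 * (x.den : ℚ) ^ 3)
      = 0 := by linear_combination hq
    exact_mod_cast this
  obtain ⟨hm, hn⟩ := h_mod x.num x.den (by exact_mod_cast congrArg (Int.cast : ℤ → ZMod 3) hx)
  have hm' := (ZMod.intCast_zmod_eq_zero_iff_dvd _ 3).1 hm
  have hn' := (ZMod.natCast_eq_zero_iff _ 3).1 hn
  exact Nat.not_coprime_of_dvd_of_dvd (by norm_num) (Int.natCast_dvd.1 hm') hn' x.reduced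

/-- The abscissae of eleven integral points. -/
def abscissa : Fin 11 → ℤ := ![7, 278, 352, 458, 502, -533, 606, -826, 831, -935, 951]

/-- The ordinates of the same points. -/
def ordinate : Fin 11 → ℤ := ![161739, 147471, 143385, 137396, 134864, 186660, 128775, 198048,
  115124, 201872, 107595]

/-- Primes separating the eleven points modulo doubles. -/
def descentPrime : Fin 11 → ℕ := ![5827, 86573, 41177, 4241, 52189, 1307, 4133, 17299, 13873,
  5987, 17989]

/-- Simple roots of the two-torsion polynomial modulo the primes `descentPrime`. -/
def descentRoot : Fin 11 → ℤ := ![694, 28277, 13974, 560, 10762, 658, 1363, 13029, 6690, 1963,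
  13511]

theorem integralModel_equation (i : Fin 11) :
    integralModel.toAffine.Equation (abscissa i) (ordinate i) := by
  rw [WeierstrassCurve.Affine.equation_iff]
  revert i
  decide

instance descentPrime_fact (i : Fin 11) : Fact (descentPrime i).Prime :=
  ⟨by fin_cases i <;> norm_num [descentPrime]⟩

theorem descentPrime_dvd (i : Fin 11) :
    (descentPrime i : ℤ) ∣ integralModel.twoTorsionPolynomial.toPoly.eval (descentRoot i) := by
  simp only [integralModel, WeierstrassCurve.twoTorsionPolynomial, Cubic.toPoly,
        WeierstrassCurve.b₂, WeierstrassCurve.b₄, WeierstrassCurve.b₆, Polynomial.eval_add,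
        Polynomial.eval_mul, Polynomial.eval_C, Polynomial.eval_pow, Polynomial.eval_X]
  revert i
  decide

theorem descentPrime_not_dvd (i : Fin 11) : ¬ (descentPrime i : ℤ) ∣
    integralModel.twoTorsionPolynomial.toPoly.derivative.eval (descentRoot i) := by
  simp [integralModel, WeierstrassCurve.twoTorsionPolynomial, Cubic.toPoly,
        WeierstrassCurve.b₂, WeierstrassCurve.b₄, WeierstrassCurve.b₆]
  revert i
  decide

theorem legendreSym_descentPrime (i j : Fin 11) :
    legendreSym (descentPrime i) (abscissa j - descentRoot i) = if i = j then -1 else 1 := by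
  fin_cases i <;> fin_cases j <;> norm_num [descentPrime, abscissa, descentRoot]

/-- The elliptic curve `[0, 0, 1, -16359067, 26274178986]` has discriminant of absolute value `18031737725935636520843`,
and its group of rational points contains `11` points that are linearly independent
over `ℤ` (so its Mordell–Weil rank is at least `11`). -/
theorem rank11_low_conductor_curve (W : WeierstrassCurve ℚ)
    (hW : W = ⟨0, 0, 1, -16359067, 26274178986⟩) :
    |W.Δ| = 18031737725935636520843 ∧
      Nat.Prime 18031737725935636520843 ∧
      ∃ P : Fin 11 → W.toAffine.Point, LinearIndependent ℤ P := by
  have hΔ : |W.Δ| = 18031737725935636520843 := by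
    subst hW
    norm_num [WeierstrassCurve.Δ, WeierstrassCurve.b₂, WeierstrassCurve.b₄, WeierstrassCurve.b₆,
      WeierstrassCurve.b₈]
  refine ⟨hΔ, prime_18031737725935636520843, ?_⟩
  have hΔ0 : W.Δ ≠ 0 := abs_ne_zero.1 (by rw [hΔ]; norm_num)
  obtain rfl : W = integralModel.map (Int.castRingHom ℚ) := by
    rw [hW]
    ext <;> simp [integralModel]
  have hP (i : Fin 11) : (integralModel.map (Int.castRingHom ℚ)).toAffine.Nonsingular
      (abscissa i) (ordinate i) :=
    (WeierstrassCurve.Affine.equation_iff_nonsingular_of_Δ_ne_zero hΔ0).1 <|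
      (WeierstrassCurve.Affine.map_equation _ Int.cast_injective _ _).2 (integralModel_equation i)
  choose φ hφ using fun i ↦ integralModel.exists_hom_eq_legendreSym
    integralModel_aeval_twoTorsionPolynomial_ne_zero (descentPrime i) (descentPrime_dvd i)
    (descentPrime_not_dvd i)
  refine ⟨fun i ↦ .some _ _ (hP i), linearIndependent_int_of_exponent_two ?_ ?_ _ φ ?_⟩
  · refine fun P ↦ WeierstrassCurve.Affine.Point.eq_zero_of_two_nsmul_eq_zero fun x hx ↦
      integralModel_aeval_twoTorsionPolynomial_ne_zero x ?_
    simpa [WeierstrassCurve.twoTorsionPolynomial, Cubic.toPoly, map_ofNat] using hx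
  · exact fun b ↦ (two_nsmul b).trans (Int.units_mul_self b.toMul)
  · intro i j
    have h := hφ i _ _ (hP j) (by rw [legendreSym_descentPrime]; split_ifs <;> norm_num)
    rw [legendreSym_descentPrime] at h
    rw [← toMul_eq_one, ← Units.val_eq_one, h]
    split_ifs with hij <;> simp [hij]
end

section
/- The elliptic curve over Q given by the Weierstrass equation y^2 + y = x^3 - 1387x + 68046 (coefficients [a1,a2,a3,a4,a6] = [0,0,1,-1387,68046]) has discriminant of absolute value 1829517077483, and its group of rational points contains 7 points that are linearly independent over Z (so the curve has Mordell–Weil rank at least 7). -/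
section PadicSquares

open Polynomial

variable {p : ℕ} [Fact p.Prime]

lemma PadicInt.toZMod_eq_zero_iff_norm_lt_one (z : ℤ_[p]) : PadicInt.toZMod z = 0 ↔ ‖z‖ < 1 := by
  rw [← RingHom.mem_ker, PadicInt.ker_toZMod, IsLocalRing.mem_maximalIdeal, PadicInt.mem_nonunits]

lemma PadicInt.exists_root_of_toZMod (F : ℤ_[p][X]) (a : ℤ_[p])
    (h0 : PadicInt.toZMod (F.eval a) = 0) (h1 : PadicInt.toZMod (F.derivative.eval a) ≠ 0) :
    ∃ z : ℤ_[p], F.eval z = 0 ∧ PadicInt.toZMod z = PadicInt.toZMod a := by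
  rw [PadicInt.toZMod_eq_zero_iff_norm_lt_one] at h0
  have h1' : ‖F.derivative.eval a‖ = 1 :=
    le_antisymm (PadicInt.norm_le_one _)
      (not_lt.1 fun h => h1 ((PadicInt.toZMod_eq_zero_iff_norm_lt_one _).2 h))
  obtain ⟨z, hz, hza, -⟩ := hensels_lemma (F := F) (a := a) (by
    simpa only [coe_aeval_eq_eval, h1', one_pow] using h0)
  rw [coe_aeval_eq_eval, h1', ← PadicInt.toZMod_eq_zero_iff_norm_lt_one, map_sub,
    sub_eq_zero] at hza
  exact ⟨z, by simpa only [coe_aeval_eq_eval] using hz, hza⟩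

lemma PadicInt.isSquare_coe_iff (hp : p ≠ 2) {u : ℤ_[p]} (hu : PadicInt.toZMod u ≠ 0) :
    IsSquare (u : ℚ_[p]) ↔ IsSquare (PadicInt.toZMod u) := by
  constructor
  · rintro ⟨s, hs⟩
    have hs1 : ‖s‖ ≤ 1 := by
      have h := PadicInt.norm_le_one u
      rw [PadicInt.norm_def, hs, norm_mul] at h
      nlinarith [norm_nonneg s]
    obtain ⟨s, rfl⟩ : ∃ s' : ℤ_[p], (s' : ℚ_[p]) = s := ⟨⟨s, hs1⟩, rfl⟩
    exact ⟨PadicInt.toZMod s, by rw [← map_mul]; exact congrArg _ (Subtype.ext hs)⟩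
  · rintro ⟨t, ht⟩
    obtain ⟨a, rfl⟩ := ZMod.ringHom_surjective (PadicInt.toZMod (p := p)) t
    have ha : PadicInt.toZMod a ≠ 0 := by
      rintro h
      exact hu (by simp [ht, h])
    have h2 : (2 : ZMod p) ≠ 0 := by
      have : Fact (2 < p) := ⟨lt_of_le_of_ne (Fact.out : p.Prime).two_le hp.symm⟩
      exact Ring.two_ne_zero (by rwa [ZMod.ringChar_zmod_n])
    obtain ⟨z, hz, -⟩ := PadicInt.exists_root_of_toZMod (X ^ 2 - C u) a
      (by simp [ht, pow_two]) (by simpa [ha, one_add_one_eq_two, map_ofNat] using h2)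
    refine ⟨z, ?_⟩
    have : u = z * z := by
      simp only [eval_sub, eval_pow, eval_X, eval_C] at hz
      linear_combination -hz
    exact_mod_cast congrArg ((↑) : ℤ_[p] → ℚ_[p]) this

end PadicSquares

namespace WeierstrassCurve.Affine

open Polynomial

section TwoDescent

variable {F L : Type*} [Field F] [Field L] [Algebra F L] (W : WeierstrassCurve.Affine F) {θ : L}

/-- The value of the function `x - θ` at an affine point, and `1` at infinity. -/
noncomputable def xSubUnit (hθ : ∀ x : F, algebraMap F L x ≠ θ) : W.Point → Lˣ
  | .zero => 1
  | .some x _ _ => Units.mk0 (algebraMap F L x - θ) (sub_ne_zero.2 (hθ x))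

lemma isSquare_prod_sub_root [NeZero (2 : L)] [DecidableEq F]
    (hroot : aeval θ W.twoTorsionPolynomial.toPoly = 0) {x₁ x₂ y₁ y₂ : F}
    (h₁ : W.Equation x₁ y₁) (h₂ : W.Equation x₂ y₂) (hxy : ¬(x₁ = x₂ ∧ y₁ = W.negY x₂ y₂)) :
    IsSquare ((algebraMap F L x₁ - θ) * (algebraMap F L x₂ - θ) *
      (algebraMap F L (W.addX x₁ x₂ (W.slope x₁ x₂ y₁ y₂)) - θ)) := by
  have h2 : (2 : L) ≠ 0 := NeZero.ne 2
  have key := congrArg (aeval θ) (addPolynomial_slope h₁ h₂ hxy)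
  rw [addPolynomial_eq] at key
  generalize W.slope x₁ x₂ y₁ y₂ = l at key ⊢
  simp only [Cubic.toPoly, twoTorsionPolynomial, b₂, b₄, b₆, map_neg, map_add, map_mul, map_sub,
    map_pow, aeval_X, aeval_C, map_one, map_ofNat] at key hroot
  refine ⟨algebraMap F L l * (θ - algebraMap F L x₁) + algebraMap F L y₁
    + (algebraMap F L W.a₁ * θ + algebraMap F L W.a₃) / 2, ?_⟩
  field_simp
  linear_combination -4 * key - hroot

/-- The `2`-descent homomorphism `P ↦ x(P) - θ` modulo squares, for a root `θ` of the
`2`-torsion polynomial outside the base field. -/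
noncomputable def twoDescentHom [NeZero (2 : L)] [DecidableEq F]
    (hroot : aeval θ W.twoTorsionPolynomial.toPoly = 0) (hθ : ∀ x : F, algebraMap F L x ≠ θ) :
    Multiplicative W.Point →* Lˣ ⧸ (powMonoidHom 2 : Lˣ →* Lˣ).range :=
  MonoidHom.mk' (fun P => QuotientGroup.mk (xSubUnit W hθ P.toAdd)) <| by
    have hsq (u : Lˣ) : QuotientGroup.mk (s := (powMonoidHom 2 : Lˣ →* Lˣ).range) (u * u) = 1 :=
      (QuotientGroup.eq_one_iff _).2 ⟨u, pow_two u⟩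
    intro P Q
    change QuotientGroup.mk (xSubUnit W hθ (P.toAdd + Q.toAdd)) = _
    generalize P.toAdd = P
    generalize Q.toAdd = Q
    rw [← QuotientGroup.mk_mul]
    rcases P with _ | ⟨x₁, y₁, h₁⟩
    · change QuotientGroup.mk (xSubUnit W hθ (0 + Q)) = QuotientGroup.mk (1 * xSubUnit W hθ Q)
      rw [zero_add, one_mul]
    rcases Q with _ | ⟨x₂, y₂, h₂⟩
    · change QuotientGroup.mk (xSubUnit W hθ (_ + 0)) = QuotientGroup.mk (xSubUnit W hθ _ * 1)
      rw [add_zero, mul_one]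
    by_cases hxy : x₁ = x₂ ∧ y₁ = W.negY x₂ y₂
    · rw [Point.add_of_Y_eq hxy.1 hxy.2]
      obtain ⟨rfl, -⟩ := hxy
      exact (hsq _).symm
    · rw [Point.add_some hxy]
      obtain ⟨s, hs⟩ := isSquare_prod_sub_root W hroot h₁.1 h₂.1 hxy
      have hs0 : s ≠ 0 := by
        rintro rfl
        simp only [mul_zero, mul_eq_zero, sub_eq_zero, hθ, or_self] at hs
      have key : xSubUnit W hθ (.some x₁ y₁ h₁) * xSubUnit W hθ (.some x₂ y₂ h₂) *
          xSubUnit W hθ (.some _ _ (nonsingular_add h₁ h₂ hxy)) =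
            Units.mk0 s hs0 * Units.mk0 s hs0 := Units.ext hs
      have h := hsq (Units.mk0 s hs0)
      rw [← key, QuotientGroup.mk_mul, mul_eq_one_iff_eq_inv] at h
      rw [h]
      exact (inv_eq_of_mul_eq_one_right (hsq _)).symm

lemma twoDescentHom_some_eq_one_iff [NeZero (2 : L)] [DecidableEq F]
    (hroot : aeval θ W.twoTorsionPolynomial.toPoly = 0) (hθ : ∀ x : F, algebraMap F L x ≠ θ)
    {x y : F} (h : W.Nonsingular x y) :
    twoDescentHom W hroot hθ (Multiplicative.ofAdd (.some x y h)) = 1 ↔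
      IsSquare (algebraMap F L x - θ) := by
  change QuotientGroup.mk (xSubUnit W hθ (.some x y h)) = _ ↔ _
  rw [QuotientGroup.eq_one_iff]
  constructor
  · rintro ⟨u, hu⟩
    exact ⟨u, by simpa [pow_two, xSubUnit] using (congrArg Units.val hu).symm⟩
  · rintro ⟨s, hs⟩
    have hs0 : s ≠ 0 := by
      rintro rfl
      simp [sub_eq_zero, hθ] at hs
    exact ⟨Units.mk0 s hs0, Units.ext (by simp [xSubUnit, hs, pow_two])⟩

lemma even_of_twoDescentHom [NeZero (2 : L)] [DecidableEq F]
    (hroot : aeval θ W.twoTorsionPolynomial.toPoly = 0) (hθ : ∀ x : F, algebraMap F L x ≠ θ)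
    {ι : Type*} [Fintype ι] {P : ι → W.Point} {c : ι → ℤ} (hc : ∑ j, c j • P j = 0) (i : ι)
    (hi : twoDescentHom W hroot hθ (Multiplicative.ofAdd (P i)) ≠ 1)
    (hj : ∀ j, j ≠ i → twoDescentHom W hroot hθ (Multiplicative.ofAdd (P j)) = 1) :
    Even (c i) := by
  classical
  have h := congrArg (fun Q => twoDescentHom W hroot hθ (Multiplicative.ofAdd Q)) hc
  simp only [ofAdd_sum, ofAdd_zsmul, map_prod, map_zpow, ofAdd_zero, map_one] at h
  rw [Finset.prod_eq_single i (fun j _ hji => by rw [hj j hji, one_zpow]) (by simp)] at h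
  by_contra hodd
  obtain ⟨k, hk⟩ := Int.not_even_iff_odd.1 hodd
  have hsq (g : Lˣ ⧸ (powMonoidHom 2 : Lˣ →* Lˣ).range) : g ^ (2 * k) = 1 := by
    obtain ⟨u, rfl⟩ := QuotientGroup.mk_surjective g
    exact (QuotientGroup.eq_one_iff (u ^ (2 * k))).2
      ⟨u ^ k, by rw [powMonoidHom_apply, mul_comm, zpow_mul, zpow_ofNat]⟩
  rw [hk, zpow_add, hsq] at h
  exact hi ((zpow_one _).symm.trans ((one_mul _).symm.trans h))

end TwoDescent

lemma Point.eq_zero_of_two_zsmul_eq_zero {F : Type*} [Field F] [DecidableEq F]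
    (W : WeierstrassCurve.Affine F) (hW : ∀ x : F, W.twoTorsionPolynomial.toPoly.eval x ≠ 0)
    (P : W.Point) (hP : (2 : ℤ) • P = 0) : P = 0 := by
  rw [two_zsmul] at hP
  rcases P with _ | ⟨x, y, h⟩
  · rfl
  · exfalso
    by_cases hy : y = W.negY x y
    · refine hW x ?_
      have he := (W.equation_iff x y).1 h.1
      rw [negY] at hy
      simp only [Cubic.toPoly, twoTorsionPolynomial, b₂, b₄, b₆, eval_add, eval_mul, eval_pow,
        eval_X, eval_C]
      linear_combination (2 * y + W.a₁ * x + W.a₃) * hy - 4 * he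
    · rw [Point.add_self_of_Y_ne hy] at hP
      exact Point.some_ne_zero _ hP

/-- If `x j` are the `x`-coordinates of rational points of `W`, and for a simple root `r` of the
`2`-torsion polynomial modulo `p` the only quadratic nonresidue among the `x j - r` is
`x i - r`, then the coefficient of the `i`-th point in every linear relation is even. -/
lemma even_of_legendreSym (W : WeierstrassCurve ℤ) {p : ℕ} [Fact p.Prime] (hp : p ≠ 2)
    (hW : ∀ x : ℚ, (W.map (Int.castRingHom ℚ)).twoTorsionPolynomial.toPoly.eval x ≠ 0)
    {ι : Type*} [Fintype ι] [DecidableEq ι] {x y : ι → ℤ}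
    (hxy : ∀ j, (W.map (Int.castRingHom ℚ)).toAffine.Nonsingular (x j) (y j))
    {c : ι → ℤ} (hc : ∑ j, c j • Point.some _ _ (hxy j) = 0) (i : ι) (r : ℤ)
    (h0 : (p : ℤ) ∣ W.twoTorsionPolynomial.toPoly.eval r)
    (h1 : ¬(p : ℤ) ∣ W.twoTorsionPolynomial.toPoly.derivative.eval r)
    (hl : ∀ j, legendreSym p (x j - r) = if j = i then -1 else 1) : Even (c i) := by
  set f := W.twoTorsionPolynomial.toPoly
  have hmap : (W.map (Int.castRingHom ℚ)).twoTorsionPolynomial.toPoly =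
      f.map (Int.castRingHom ℚ) := by
    simp [f, twoTorsionPolynomial, Cubic.toPoly, C_ofNat]
  rw [hmap] at hW
  have hcast (g : ℤ[X]) : PadicInt.toZMod ((g.map (Int.castRingHom ℤ_[p])).eval (r : ℤ_[p])) =
      ((g.eval r : ℤ) : ZMod p) := by
    rw [eval_intCast_map]; simp
  obtain ⟨t, ht, htr⟩ := PadicInt.exists_root_of_toZMod (f.map (Int.castRingHom ℤ_[p])) r
    (by rw [hcast, ZMod.intCast_zmod_eq_zero_iff_dvd]; exact h0)
    (by rw [derivative_map, hcast, Ne, ZMod.intCast_zmod_eq_zero_iff_dvd]; exact h1)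
  have hroot : aeval (t : ℚ_[p])
      (W.map (Int.castRingHom ℚ)).toAffine.twoTorsionPolynomial.toPoly = 0 := by
    have h := congrArg (PadicInt.Coe.ringHom (p := p)) ht
    rw [hmap, aeval_def, eval₂_map]
    rw [eval_map, hom_eval₂, map_zero] at h
    rwa [RingHom.ext_int ((algebraMap ℚ ℚ_[p]).comp _) (PadicInt.Coe.ringHom.comp _)]
  have hθ (q : ℚ) : algebraMap ℚ ℚ_[p] q ≠ t := by
    intro hq
    rw [← hq, aeval_algebraMap_apply, map_eq_zero, hmap] at hroot
    exact hW q (by simpa using hroot)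
  have hu (j : ι) : PadicInt.toZMod ((x j : ℤ_[p]) - t) = ((x j - r : ℤ) : ZMod p) := by
    simp [htr]
  have hne (j : ι) : ((x j - r : ℤ) : ZMod p) ≠ 0 := by
    rw [Ne, ← legendreSym.eq_zero_iff, hl]
    split_ifs <;> decide
  have hsq (j : ι) : twoDescentHom _ hroot hθ (Multiplicative.ofAdd (.some _ _ (hxy j))) = 1 ↔
      IsSquare ((x j - r : ℤ) : ZMod p) := by
    rw [twoDescentHom_some_eq_one_iff, ← hu,
      ← PadicInt.isSquare_coe_iff hp (by rw [hu]; exact hne j)]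
    simp
  refine even_of_twoDescentHom _ hroot hθ hc i ?_ ?_
  · rw [Ne, hsq, ← legendreSym.eq_neg_one_iff, hl, if_pos rfl]
  · intro j hj
    rw [hsq, ← legendreSym.eq_one_iff p (hne j), hl, if_neg hj]

end WeierstrassCurve.Affine

lemma linearIndependent_of_forall_even {G ι : Type*} [AddCommGroup G] [Fintype ι] {P : ι → G}
    (htors : ∀ g : G, (2 : ℤ) • g = 0 → g = 0)
    (heven : ∀ c : ι → ℤ, ∑ i, c i • P i = 0 → ∀ i, Even (c i)) : LinearIndependent ℤ P := by
  have hpow (n : ℕ) : ∀ c : ι → ℤ, ∑ i, c i • P i = 0 → ∀ i, (2 : ℤ) ^ n ∣ c i := by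
    induction n with
    | zero => simp
    | succ n ih =>
      intro c hc
      choose d hd using fun i => (heven c hc i).two_dvd
      have hd0 : ∑ i, d i • P i = 0 := htors _ <| by
        simpa only [Finset.smul_sum, smul_smul, ← hd] using hc
      intro i
      rw [hd i, pow_succ']
      exact mul_dvd_mul_left 2 (ih d hd0 i)
  refine Fintype.linearIndependent_iff.2 fun c hc i => ?_
  refine Int.eq_zero_of_abs_lt_dvd (hpow (c i).natAbs c hc i) ?_
  rw [Int.abs_eq_natAbs]
  exact_mod_cast Nat.lt_two_pow_self

/-- An integral model of the curve. -/
def rankSevenCurve : WeierstrassCurve ℤ := ⟨0, 0, 1, -1387, 68046⟩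

/-- The `x`-coordinates of seven integral points. -/
def rankSevenX : Fin 7 → ℤ := ![-49, -47, -44, -43, -42, -34, -30]

/-- The `y`-coordinates of seven integral points. -/
def rankSevenY : Fin 7 → ℤ := ![135, 171, 209, 219, 228, 275, 287]

open Polynomial in
lemma rankSevenCurve_eval_twoTorsionPolynomial_ne_zero (x : ℚ) :
    (rankSevenCurve.map (Int.castRingHom ℚ)).twoTorsionPolynomial.toPoly.eval x ≠ 0 := by
  intro hx
  simp [WeierstrassCurve.twoTorsionPolynomial, WeierstrassCurve.b₂, WeierstrassCurve.b₄,
    WeierstrassCurve.b₆, Cubic.toPoly, rankSevenCurve] at hx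
  have hint : IsIntegral ℤ (4 * x) := by
    refine ⟨X ^ 3 - 22192 * X + 4354960, by monicity!, ?_⟩
    simp [eval₂_add, eval₂_sub]
    linear_combination 16 * hx
  obtain ⟨z, hz⟩ := IsIntegrallyClosed.isIntegral_iff.1 hint
  have hz' : z ^ 3 - 22192 * z + 4354960 = 0 := by
    have hz0 : (z : ℚ) = 4 * x := by simpa using hz
    have : (z : ℚ) ^ 3 - 22192 * z + 4354960 = 0 := by
      rw [hz0]
      linear_combination 16 * hx
    exact_mod_cast this
  have hmod : ∀ w : ZMod 3, w ^ 3 - 22192 * w + 4354960 ≠ 0 := by decide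
  exact hmod z (by exact_mod_cast congrArg (Int.cast : ℤ → ZMod 3) hz')

lemma rankSevenCurve_nonsingular (j : Fin 7) :
    (rankSevenCurve.map (Int.castRingHom ℚ)).toAffine.Nonsingular
      (rankSevenX j) (rankSevenY j) := by
  rw [WeierstrassCurve.Affine.nonsingular_iff, WeierstrassCurve.Affine.equation_iff]
  fin_cases j <;> norm_num [rankSevenCurve, rankSevenX, rankSevenY]

/-- For each index `i`, a prime and a root of the `2`-torsion polynomial modulo it that
detect the parity of the `i`-th coefficient. -/
lemma rankSevenCurve_exists_detecting_prime (i : Fin 7) : ∃ p : ℕ, ∃ _ : Fact p.Prime, ∃ r : ℤ,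
    p ≠ 2 ∧ (p : ℤ) ∣ rankSevenCurve.twoTorsionPolynomial.toPoly.eval r ∧
      ¬(p : ℤ) ∣ rankSevenCurve.twoTorsionPolynomial.toPoly.derivative.eval r ∧
      ∀ j, legendreSym p (rankSevenX j - r) = if j = i then -1 else 1 := by
  have key (p : ℕ) (r : ℤ) (hp : p.Prime) (hp2 : p ≠ 2)
      (h0 : (p : ℤ) ∣ 4 * r ^ 3 - 5548 * r + 272185) (h1 : ¬(p : ℤ) ∣ 12 * r ^ 2 - 5548)
      (hl : ∀ j, jacobiSym (rankSevenX j - r) p = if j = i then -1 else 1) :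
      ∃ p : ℕ, ∃ _ : Fact p.Prime, ∃ r : ℤ,
        p ≠ 2 ∧ (p : ℤ) ∣ rankSevenCurve.twoTorsionPolynomial.toPoly.eval r ∧
          ¬(p : ℤ) ∣ rankSevenCurve.twoTorsionPolynomial.toPoly.derivative.eval r ∧
          ∀ j, legendreSym p (rankSevenX j - r) = if j = i then -1 else 1 := by
    have : Fact p.Prime := ⟨hp⟩
    refine ⟨p, this, r, hp2, ?_, ?_, fun j => by rw [jacobiSym.legendreSym.to_jacobiSym, hl]⟩
    · convert h0 using 1
      simp [WeierstrassCurve.twoTorsionPolynomial, WeierstrassCurve.b₂, WeierstrassCurve.b₄,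
        WeierstrassCurve.b₆, Cubic.toPoly, rankSevenCurve]
      ring
    · convert h1 using 2
      simp [WeierstrassCurve.twoTorsionPolynomial, WeierstrassCurve.b₂, WeierstrassCurve.b₄,
        WeierstrassCurve.b₆, Cubic.toPoly, rankSevenCurve]
      ring
  fin_cases i
  · refine key 139 67 (by norm_num) (by norm_num) (by norm_num) (by norm_num) fun j => ?_
    fin_cases j <;> norm_num [rankSevenX]
  · refine key 1999 945 (by norm_num) (by norm_num) (by norm_num) (by norm_num) fun j => ?_
    fin_cases j <;> norm_num [rankSevenX]
  · refine key 2239 552 (by norm_num) (by norm_num) (by norm_num) (by norm_num) fun j => ?_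
    fin_cases j <;> norm_num [rankSevenX]
  · refine key 277 37 (by norm_num) (by norm_num) (by norm_num) (by norm_num) fun j => ?_
    fin_cases j <;> norm_num [rankSevenX]
  · refine key 67 14 (by norm_num) (by norm_num) (by norm_num) (by norm_num) fun j => ?_
    fin_cases j <;> norm_num [rankSevenX]
  · refine key 1831 134 (by norm_num) (by norm_num) (by norm_num) (by norm_num) fun j => ?_
    fin_cases j <;> norm_num [rankSevenX]
  · refine key 47 44 (by norm_num) (by norm_num) (by norm_num) (by norm_num) fun j => ?_
    fin_cases j <;> norm_num [rankSevenX]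

/-- The elliptic curve `[0, 0, 1, -1387, 68046]` has discriminant of absolute value `1829517077483`,
and its group of rational points contains `7` points that are linearly independent
over `ℤ` (so its Mordell–Weil rank is at least `7`). -/
theorem rank7_low_discriminant_curve (W : WeierstrassCurve ℚ)
    (hW : W = ⟨0, 0, 1, -1387, 68046⟩) :
    |W.Δ| = 1829517077483 ∧
      ∃ P : Fin 7 → W.toAffine.Point, LinearIndependent ℤ P := by
  constructor
  · norm_num [hW, WeierstrassCurve.Δ, WeierstrassCurve.b₂, WeierstrassCurve.b₄,
      WeierstrassCurve.b₆, WeierstrassCurve.b₈]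
  · obtain rfl : W = rankSevenCurve.map (Int.castRingHom ℚ) := by
      rw [hW]
      ext <;> simp [rankSevenCurve]
    refine ⟨fun j => .some _ _ (rankSevenCurve_nonsingular j),
      linearIndependent_of_forall_even
        (WeierstrassCurve.Affine.Point.eq_zero_of_two_zsmul_eq_zero _
          rankSevenCurve_eval_twoTorsionPolynomial_ne_zero) fun c hc i => ?_⟩
    obtain ⟨p, _, r, hp, h0, h1, hl⟩ := rankSevenCurve_exists_detecting_prime i
    exact WeierstrassCurve.Affine.even_of_legendreSym rankSevenCurve hp
      rankSevenCurve_eval_twoTorsionPolynomial_ne_zero rankSevenCurve_nonsingular hc i r h0 h1 hl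
end
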